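/- arXiv:2504.21253 — 2 statements merged into one kernel-verified Lean document; each statement's English description precedes it below -/
import Mathlib

section
/- Let n ≥ 2, 0 < q < n and 0 < λ ≤ Λ. Let v be a generalized solution of λ v^q χ_{{v>0}} ≤ det D²v ≤ Λ v^q χ_{{v>0}} in Ω. Suppose K := {v = 0} = {0} and the sublevel set S₁ := {x ∈ Ω : v(x) ≤ 1} is a compact subset of Ω. Then there exist α ∈ (0,1) and constants 0 < c < C, depending only on n, q, λ, Λ, and an invertible linear map T : ℝⁿ → ℝⁿ with |det T| = 1, such that, setting ṽ := v ∘ T⁻¹ (defined on T(Ω)): B_c(0) ⊆ T(S₁) ⊆ B_C(0); ṽ is differentiable at every point of {ṽ ≤ 1/2} with sup(|ṽ| + |∇ṽ|) ≤ C and |∇ṽ(x) − ∇ṽ(y)| ≤ C|x−y|^α on {ṽ ≤ 1/2}; and c|x|^{(1+α)/α} ≤ ṽ(x) ≤ C|x|^{1+α} for all x ∈ B_c(0). -/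
open MeasureTheory Set Metric
open scoped RealInnerProductSpace

noncomputable section

/-- The subdifferential of a convex function `v` at `x`, relative to the domain `Ω`. -/
def subgrad {n : ℕ} (Ω : Set (EuclideanSpace ℝ (Fin n))) (v : EuclideanSpace ℝ (Fin n) → ℝ)
    (x : EuclideanSpace ℝ (Fin n)) : Set (EuclideanSpace ℝ (Fin n)) :=
  {p | ∀ y ∈ Ω, v x + ⟪p, y - x⟫ ≤ v y}

/-- The image `∂v(E) = ⋃_{x ∈ E} ∂v(x)` of a set under the subdifferential. -/
def subgradImg {n : ℕ} (Ω : Set (EuclideanSpace ℝ (Fin n))) (v : EuclideanSpace ℝ (Fin n) → ℝ)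
    (E : Set (EuclideanSpace ℝ (Fin n))) : Set (EuclideanSpace ℝ (Fin n)) :=
  ⋃ x ∈ E, subgrad Ω v x

/-- The last coordinate `x_n` of a point of `ℝⁿ`. -/
def lastCoord {n : ℕ} (x : EuclideanSpace ℝ (Fin n)) : ℝ :=
  if h : 0 < n then x ⟨n - 1, by omega⟩ else 0

/-- The first `n-1` coordinates `x'` of a point of `ℝⁿ`. -/
def fstCoords {n : ℕ} (x : EuclideanSpace ℝ (Fin n)) : EuclideanSpace ℝ (Fin (n - 1)) :=
  (EuclideanSpace.equiv (Fin (n - 1)) ℝ).symm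
    (fun i => x ⟨i, lt_of_lt_of_le i.isLt (Nat.sub_le n 1)⟩)

/-- The point `(x', t) ∈ ℝⁿ = ℝ^{n-1} × ℝ`. -/
def app (n : ℕ) (x' : EuclideanSpace ℝ (Fin (n - 1))) (t : ℝ) : EuclideanSpace ℝ (Fin n) :=
  (EuclideanSpace.equiv (Fin n) ℝ).symm
    (fun i => if h : (i : ℕ) < n - 1 then x' ⟨i, h⟩ else t)

/-- `v` is a generalized (Aleksandrov) solution of
`λ v^q χ_{v>0} ≤ det D²v ≤ Λ v^q χ_{v>0}` on the open convex set `Ω`: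
`v` is continuous, convex and nonnegative on `Ω`, and for every Borel `E ⊆ Ω` one has
`|∂v(E)| ≤ Λ ∫_{E ∩ {v>0}} v^q` and `|∂v(E ∩ {v>0})| ≥ λ ∫_{E ∩ {v>0}} v^q`. -/
def GenSol (n : ℕ) (q lam Lam : ℝ) (Ω : Set (EuclideanSpace ℝ (Fin n)))
    (v : EuclideanSpace ℝ (Fin n) → ℝ) : Prop :=
  ContinuousOn v Ω ∧ ConvexOn ℝ Ω v ∧ (∀ x ∈ Ω, 0 ≤ v x) ∧
  (∀ E : Set (EuclideanSpace ℝ (Fin n)), MeasurableSet E → E ⊆ Ω →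
    volume (subgradImg Ω v E) ≤
      ENNReal.ofReal Lam * ∫⁻ x in E ∩ {x | 0 < v x}, ENNReal.ofReal (v x ^ q)) ∧
  (∀ E : Set (EuclideanSpace ℝ (Fin n)), MeasurableSet E → E ⊆ Ω →
    ENNReal.ofReal lam * ∫⁻ x in E ∩ {x | 0 < v x}, ENNReal.ofReal (v x ^ q) ≤
      volume (subgradImg Ω v (E ∩ {x | 0 < v x})))

/-- The coincidence set `K = {x ∈ Ω : v x = 0}`. -/
def coin {n : ℕ} (Ω : Set (EuclideanSpace ℝ (Fin n))) (v : EuclideanSpace ℝ (Fin n) → ℝ) :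
    Set (EuclideanSpace ℝ (Fin n)) :=
  {x ∈ Ω | v x = 0}

/-- Euclidean `n`-space. -/
abbrev Eucl (n : ℕ) := EuclideanSpace ℝ (Fin n)

/-- The absolute value of the determinant of a continuous linear automorphism of `ℝⁿ`. -/
def absDet {n : ℕ} (A : Eucl n ≃L[ℝ] Eucl n) : ℝ :=
  |LinearMap.det (A.toLinearEquiv : Eucl n →ₗ[ℝ] Eucl n)|

theorem absDet_pos {n : ℕ} (A : Eucl n ≃L[ℝ] Eucl n) : 0 < absDet A :=
  abs_pos.2 (LinearEquiv.isUnit_det' A.toLinearEquiv).ne_zero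

/-- The volume of the closed unit ball of `ℝⁿ`. -/
def ballVol (n : ℕ) : ℝ := volume.real (closedBall (0 : Eucl n) 1)

theorem ballVol_pos (n : ℕ) : 0 < ballVol n := by
  have h : 0 < volume (closedBall (0 : Eucl n) 1) := measure_closedBall_pos _ _ one_pos
  exact ENNReal.toReal_pos h.ne' measure_closedBall_lt_top.ne

theorem volume_closedBall_eq {n : ℕ} (x : Eucl n) {r : ℝ} (hr : 0 ≤ r) :
    volume (closedBall x r) = ENNReal.ofReal (r ^ n * ballVol n) := by
  rw [ENNReal.ofReal_mul (by positivity), ballVol, Measure.real,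
    ENNReal.ofReal_toReal measure_closedBall_lt_top.ne, Measure.addHaar_closedBall _ _ hr,
    Measure.addHaar_closedBall _ (0 : Eucl n) zero_le_one]
  simp

theorem volume_image_affine {n : ℕ} (f : Eucl n →ₗ[ℝ] Eucl n) (b : Eucl n) (s : Set (Eucl n)) :
    volume ((fun z => b + f z) '' s) = ENNReal.ofReal |LinearMap.det f| * volume s := by
  have h : (fun z => b + f z) '' s = (fun y => b + y) '' (f '' s) := by
    rw [image_image]
  rw [h, ← Measure.addHaar_image_linearMap, image_add_left, measure_preimage_add]

theorem volume_ellipsoid {n : ℕ} (A : Eucl n ≃L[ℝ] Eucl n) (b : Eucl n) {r : ℝ} (hr : 0 ≤ r) :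
    volume ((fun z => b + A z) '' closedBall 0 r) =
      ENNReal.ofReal (absDet A * r ^ n * ballVol n) := by
  have := volume_image_affine (A.toLinearEquiv : Eucl n →ₗ[ℝ] Eucl n) b (closedBall 0 r)
  rw [volume_closedBall_eq _ hr, ← ENNReal.ofReal_mul (abs_nonneg _)] at this
  rw [mul_assoc]
  exact this

/-- A convex set containing a ball and a far away point has large volume. -/
theorem volume_ge_of_ball_of_mem {n : ℕ} {W : Set (Eucl n)} (hW : Convex ℝ W) {ρ K : ℝ}
    (hρ : 0 < ρ) (hball : closedBall 0 ρ ⊆ W) {s : Eucl n} (hs : s ∈ W) (hK : 0 < K)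
    (hKs : K * ρ ≤ ‖s‖) :
    ENNReal.ofReal ((1 / 2) ^ (n + 1) * K * ρ ^ n * ballVol n) ≤ volume W := by
  have hs0 : 0 < ‖s‖ := lt_of_lt_of_le (by positivity) hKs
  let φ : Module.Dual ℝ (Eucl n) := ((‖s‖ * ρ)⁻¹ / 2) • (innerₗ (Eucl n) s)
  let f : Eucl n →ₗ[ℝ] Eucl n := (1 / 2 : ℝ) • LinearMap.transvection φ s
  have hφ : ∀ z, φ z = (‖s‖ * ρ)⁻¹ / 2 * ⟪s, z⟫ := fun z => by simp [φ]
  have hφs : φ s = ‖s‖ / (2 * ρ) := by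
    rw [hφ, real_inner_self_eq_norm_sq]; field_simp
  have hdet : LinearMap.det f = (1 / 2) ^ n * (1 + ‖s‖ / (2 * ρ)) := by
    simp only [f, LinearMap.det_smul, LinearMap.transvection.det, hφs, finrank_euclideanSpace_fin]
  have hsub : (fun z => (1 / 4 : ℝ) • s + f z) '' closedBall 0 ρ ⊆ W := by
    rintro _ ⟨z, hz, rfl⟩
    have hz' : ‖z‖ ≤ ρ := by simpa using hz
    have hin : |⟪s, z⟫| ≤ ‖s‖ * ρ :=
      (abs_real_inner_le_norm s z).trans (by gcongr)
    have hb := abs_le.1 hin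
    have hsr : 0 < ‖s‖ * ρ := by positivity
    set θ : ℝ := (‖s‖ * ρ)⁻¹ * ⟪s, z⟫ with hθ
    have h1 : θ ≤ 1 := by
      rw [hθ, inv_mul_le_iff₀ hsr]; linarith [hb.2]
    have h2 : -1 ≤ θ := by
      rw [hθ, le_inv_mul_iff₀ hsr]; linarith [hb.1]
    have heq : (1 / 4 : ℝ) • s + f z
        = (1 / 2 : ℝ) • z + (1 / 2 : ℝ) • (((1 + θ) / 2) • s + (1 - (1 + θ) / 2) • (0 : Eucl n)) := by
      simp only [f, LinearMap.smul_apply, LinearMap.transvection.apply, hφ]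
      rw [smul_zero, add_zero, smul_add, smul_smul, smul_smul, add_left_comm, ← add_smul]
      congr 2
      rw [hθ]; ring
    simp only [heq]
    refine hW (hball hz) (hW hs (hball (by simpa using hρ.le)) ?_ ?_ ?_) ?_ ?_ ?_ <;> linarith
  have hvol := volume_image_affine f ((1 / 4 : ℝ) • s) (closedBall 0 ρ)
  rw [volume_closedBall_eq _ hρ.le, ← ENNReal.ofReal_mul (abs_nonneg _)] at hvol
  refine le_trans ?_ (measure_mono hsub)
  rw [hvol, hdet]
  apply ENNReal.ofReal_le_ofReal
  have h3 : K / 2 ≤ 1 + ‖s‖ / (2 * ρ) := by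
    have : K / 2 ≤ ‖s‖ / (2 * ρ) := by
      rw [div_le_div_iff₀ two_pos (by positivity)]; linarith
    linarith
  rw [abs_of_nonneg (by positivity)]
  have hb := ballVol_pos n
  calc (1 / 2 : ℝ) ^ (n + 1) * K * ρ ^ n * ballVol n
      = (1 / 2) ^ n * (K / 2) * (ρ ^ n * ballVol n) := by ring
    _ ≤ (1 / 2) ^ n * (1 + ‖s‖ / (2 * ρ)) * (ρ ^ n * ballVol n) := by gcongr

/-- The volume of the preimage under the adjoint of a linear automorphism. -/
theorem volume_preimage_adjoint {n : ℕ} (A : Eucl n ≃L[ℝ] Eucl n) (s : Set (Eucl n)) :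
    volume ((ContinuousLinearMap.adjoint (A : Eucl n →L[ℝ] Eucl n)) ⁻¹' s) =
      ENNReal.ofReal (absDet A)⁻¹ * volume s := by
  have hdet : LinearMap.det (LinearMap.adjoint (A.toLinearEquiv : Eucl n →ₗ[ℝ] Eucl n)) =
      LinearMap.det (A.toLinearEquiv : Eucl n →ₗ[ℝ] Eucl n) := by
    let b := EuclideanSpace.basisFun (Fin n) ℝ
    rw [← LinearMap.det_toMatrix b.toBasis, LinearMap.toMatrix_adjoint,
      ← LinearMap.det_toMatrix b.toBasis, Matrix.det_conjTranspose, star_trivial]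
  have h := Measure.addHaar_preimage_linearMap (volume : Measure (Eucl n))
    (f := LinearMap.adjoint (A.toLinearEquiv : Eucl n →ₗ[ℝ] Eucl n))
    (by rw [hdet]; exact (LinearEquiv.isUnit_det' A.toLinearEquiv).ne_zero) s
  rw [hdet, abs_inv] at h
  exact h

/-- An upper bound on the volume of the polar of an ellipsoid. -/
theorem volume_polar_le {n : ℕ} (A : Eucl n ≃L[ℝ] Eucl n) {κ : ℝ} (hκ : 0 ≤ κ) (k : Eucl n)
    {P : Set (Eucl n)} (hP : ∀ p ∈ P, ∀ z, ‖z‖ ≤ 1 → ⟪p - k, A z⟫ ≤ κ) :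
    volume P ≤ ENNReal.ofReal ((absDet A)⁻¹ * κ ^ n * ballVol n) := by
  set B := ContinuousLinearMap.adjoint (A : Eucl n →L[ℝ] Eucl n) with hB
  have hsub : P ⊆ (fun p => -k + p) ⁻¹' (B ⁻¹' closedBall 0 κ) := by
    intro p hp
    simp only [mem_preimage, mem_closedBall, dist_zero_right]
    rw [neg_add_eq_sub]
    by_contra! hlt
    have h0 : 0 < ‖B (p - k)‖ := lt_of_le_of_lt hκ hlt
    have h1 := hP p hp (‖B (p - k)‖⁻¹ • B (p - k)) (by
      rw [norm_smul, norm_inv, norm_norm, inv_mul_cancel₀ h0.ne'])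
    have h2 : ⟪p - k, A (‖B (p - k)‖⁻¹ • B (p - k))⟫ = ‖B (p - k)‖ := by
      rw [map_smul, inner_smul_right]
      have : ⟪p - k, A (B (p - k))⟫ = ⟪B (p - k), B (p - k)⟫ := by
        conv_rhs => rw [hB, ContinuousLinearMap.adjoint_inner_left]
        rfl
      rw [this, real_inner_self_eq_norm_sq]
      field_simp
    linarith
  refine (measure_mono hsub).trans ?_
  rw [measure_preimage_add, hB, volume_preimage_adjoint, volume_closedBall_eq _ hκ,
    ← ENNReal.ofReal_mul (inv_nonneg.2 (absDet_pos A).le), mul_assoc]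

/-- A lower bound on the volume of the polar of a convex set of comparable size to an ellipsoid. -/
theorem volume_polar_ge {n : ℕ} (A : Eucl n ≃L[ℝ] Eucl n) {u ρ : ℝ} (hu : 0 < u) (hρ : 0 < ρ)
    {V : Set (Eucl n)} (hV : ∀ y ∈ V, ‖A.symm y‖ ≤ ρ) (k : Eucl n) :
    ENNReal.ofReal ((absDet A)⁻¹ * (u / ρ) ^ n * ballVol n) ≤
      volume {p : Eucl n | ∀ y ∈ V, ⟪p - k, y⟫ ≤ u} := by
  have hsub : (fun p => -k + p) ⁻¹' ((ContinuousLinearMap.adjoint (A : Eucl n →L[ℝ] Eucl n)) ⁻¹'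
      closedBall 0 (u / ρ)) ⊆ {p : Eucl n | ∀ y ∈ V, ⟪p - k, y⟫ ≤ u} := by
    intro p hp y hy
    simp only [mem_preimage, mem_closedBall, dist_zero_right, neg_add_eq_sub] at hp
    have h1 : ⟪p - k, y⟫ = ⟪ContinuousLinearMap.adjoint (A : Eucl n →L[ℝ] Eucl n) (p - k),
        A.symm y⟫ := by
      rw [ContinuousLinearMap.adjoint_inner_left]; simp
    rw [h1]
    refine (real_inner_le_norm _ _).trans ?_
    calc _ ≤ u / ρ * ρ := by gcongr; exact hV y hy
      _ = u := by field_simp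
  refine le_trans ?_ (measure_mono hsub)
  rw [measure_preimage_add, volume_preimage_adjoint, volume_closedBall_eq _ (by positivity),
    ← ENNReal.ofReal_mul (inv_nonneg.2 (absDet_pos A).le), mul_assoc]

/-- An improved lower bound on the volume of the polar of a convex set, when the latter is
contained in a thin slab on one side. -/
theorem volume_polar_ge_of_slab {n : ℕ} (A : Eucl n ≃L[ℝ] Eucl n) {u ρ δ : ℝ} (hu : 0 < u)
    (hρ : 0 < ρ) (hδ : 0 < δ) {V : Set (Eucl n)} (hV : ∀ y ∈ V, ‖A.symm y‖ ≤ ρ) (k p₀ : Eucl n)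
    (hp₀ : ∀ y ∈ V, ⟪p₀, y⟫ ≤ 1) {w : Eucl n} (hw : w ∈ V) (hw₀ : 1 ≤ δ * ⟪p₀, -w⟫) :
    ENNReal.ofReal ((absDet A)⁻¹ * ((1 / 2) ^ (n + 1) * (1 / δ) * (u / ρ) ^ n * ballVol n)) ≤
      volume {p : Eucl n | ∀ y ∈ V, ⟪p - k, y⟫ ≤ u} := by
  set B := ContinuousLinearMap.adjoint (A : Eucl n →L[ℝ] Eucl n) with hB
  have hBi : ∀ p y, ⟪p, y⟫ = ⟪B p, A.symm y⟫ := fun p y => by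
    rw [hB, ContinuousLinearMap.adjoint_inner_left]; simp
  set W : Set (Eucl n) := {s | ∀ y ∈ V, ⟪s, A.symm y⟫ ≤ u} with hWdef
  have hWc : Convex ℝ W := by
    intro s hs t ht a b ha hb hab y hy
    rw [inner_add_left, inner_smul_left, inner_smul_left]
    simp only [conj_trivial]
    calc a * ⟪s, A.symm y⟫ + b * ⟪t, A.symm y⟫ ≤ a * u + b * u := by
          gcongr
          · exact hs y hy
          · exact ht y hy
      _ = u := by rw [← add_mul, hab, one_mul]
  have hsub : (fun p => -k + p) ⁻¹' (B ⁻¹' W) ⊆ {p : Eucl n | ∀ y ∈ V, ⟪p - k, y⟫ ≤ u} := by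
    intro p hp y hy
    simp only [mem_preimage, neg_add_eq_sub] at hp
    rw [hBi]
    exact hp y hy
  have hball : closedBall 0 (u / ρ) ⊆ W := by
    intro s hs y hy
    have hs' : ‖s‖ ≤ u / ρ := by simpa using hs
    refine (real_inner_le_norm _ _).trans ?_
    calc _ ≤ u / ρ * ρ := by gcongr; exact hV y hy
      _ = u := by field_simp
  have hs : u • B p₀ ∈ W := by
    intro y hy
    rw [inner_smul_left, ← hBi]
    simp only [conj_trivial]
    nlinarith [hp₀ y hy]
  have hnorm : 1 / δ * (u / ρ) ≤ ‖u • B p₀‖ := by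
    rw [norm_smul, Real.norm_of_nonneg hu.le]
    have h1 : ⟪p₀, -w⟫ ≤ ‖B p₀‖ * ρ := by
      rw [hBi]
      refine (real_inner_le_norm _ _).trans ?_
      gcongr
      simpa using hV w hw
    have h2 : 1 ≤ δ * (‖B p₀‖ * ρ) := hw₀.trans (by gcongr)
    rw [div_mul_div_comm, one_mul, div_le_iff₀ (by positivity)]
    nlinarith
  refine le_trans ?_ (measure_mono hsub)
  rw [measure_preimage_add, hB, volume_preimage_adjoint,
    ENNReal.ofReal_mul (inv_nonneg.2 (absDet_pos A).le)]
  gcongr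
  exact volume_ge_of_ball_of_mem hWc (by positivity) hball hs (by positivity) hnorm

/-- The ratio between the outer and the inner ellipsoid in `exists_ellipsoid`. -/
def ellRatio (n : ℕ) : ℝ := 4 * n ^ 2

theorem exists_auerbach {n : ℕ} {K : Set (Eucl n)} (hK : IsCompact K) (h0 : (0 : Eucl n) ∈ interior K) :
    ∃ b : Module.Basis (Fin n) ℝ (Eucl n), (∀ i, b i ∈ K) ∧ ∀ y ∈ K, ∀ i, |b.repr y i| ≤ 1 := by
  classical
  let e := (EuclideanSpace.basisFun (Fin n) ℝ).toBasis
  have hcont : Continuous fun v : Fin n → Eucl n => |e.det v| := by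
    have h : (fun v : Fin n → Eucl n => |e.det v|) = fun v => |(e.toMatrix v).det| := rfl
    rw [h]
    refine Continuous.abs ?_
    refine Continuous.matrix_det (continuous_matrix fun i j => ?_)
    simp only [Module.Basis.toMatrix_apply, e, OrthonormalBasis.coe_toBasis_repr_apply,
      EuclideanSpace.basisFun_repr]
    fun_prop
  have hKn : IsCompact (Set.pi univ fun _ : Fin n => K) := isCompact_univ_pi fun _ => hK
  obtain ⟨x, hxK, hmax⟩ := hKn.exists_isMaxOn ⟨fun _ => 0, fun _ _ => interior_subset h0⟩
    hcont.continuousOn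
  have hpos : 0 < |e.det x| := by
    obtain ⟨ε, hε, hεK⟩ := Metric.mem_nhds_iff.1 (mem_interior_iff_mem_nhds.1 h0)
    have hmem : (fun i => (ε / 2) • e i) ∈ Set.pi univ fun _ : Fin n => K := by
      intro i _
      apply hεK
      simp only [mem_ball, dist_zero_right, norm_smul, e, OrthonormalBasis.coe_toBasis,
        OrthonormalBasis.norm_eq_one]
      rw [Real.norm_of_nonneg (by positivity)]
      linarith
    have h1 := hmax hmem
    simp only [mem_ofPred_eq] at h1
    refine lt_of_lt_of_le ?_ h1
    have h2 := e.det.map_smul_univ (fun _ => ε / 2) e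
    rw [h2, Module.Basis.det_self]
    simp only [Finset.prod_const, smul_eq_mul, mul_one]
    positivity
  have hunit : IsUnit (e.det x) := (abs_pos.1 hpos).isUnit
  obtain ⟨hli, hsp⟩ := (Module.Basis.is_basis_iff_det e).2 hunit
  refine ⟨Module.Basis.mk hli hsp.ge, fun i => by simpa using hxK i (mem_univ i), fun y hy i => ?_⟩
  have h3 := congrArg (fun f => f y) (Module.Basis.det_smul_mk_coord_eq_det_update e hli hsp.ge i)
  have h4 : e.det x * (Module.Basis.mk hli hsp.ge).repr y i = e.det (Function.update x i y) := by
    simpa using h3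
  have h5 : Function.update x i y ∈ Set.pi univ fun _ : Fin n => K := by
    intro j _
    by_cases hj : j = i
    · subst hj; simpa using hy
    · simpa [Function.update_of_ne hj] using hxK j (mem_univ j)
  have h6 := hmax h5
  simp only [mem_ofPred_eq] at h6
  rw [← h4, abs_mul] at h6
  exact le_of_mul_le_mul_left (by linarith) hpos

/-- A convex body is comparable to an ellipsoid. -/
theorem exists_ellipsoid {n : ℕ} (hn : 0 < n) {Z : Set (Eucl n)} (hZ : IsCompact Z)
    (hZc : Convex ℝ Z) (hZi : (interior Z).Nonempty) :
    ∃ (A : Eucl n ≃L[ℝ] Eucl n) (b : Eucl n), (∀ z, ‖z‖ ≤ 1 → b + A z ∈ Z) ∧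
      ∀ y ∈ Z, ‖A.symm (y - b)‖ ≤ ellRatio n := by
  obtain ⟨x₀, hx₀⟩ := hZi
  have hK : IsCompact ((fun y => x₀ + y) ⁻¹' Z) :=
    (Homeomorph.addLeft x₀).isCompact_preimage.2 hZ
  have h0 : (0 : Eucl n) ∈ interior ((fun y => x₀ + y) ⁻¹' Z) := by
    have : (fun y => x₀ + y) ⁻¹' interior Z ⊆ interior ((fun y => x₀ + y) ⁻¹' Z) :=
      preimage_interior_subset_interior_preimage (by fun_prop)
    exact this (by simpa using hx₀)
  obtain ⟨β, hβ, hcoord⟩ := exists_auerbach hK h0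
  have hn' : (0 : ℝ) < n := by exact_mod_cast hn
  have hn1 : (1 : ℝ) ≤ n := by exact_mod_cast hn
  have hs : (1 / (2 * n) : ℝ) ≠ 0 := by positivity
  let A₀ : Eucl n ≃ₗ[ℝ] Eucl n := ((WithLp.linearEquiv 2 ℝ (Fin n → ℝ)).trans β.equivFun.symm).trans
    (LinearEquiv.smulOfNeZero ℝ (Eucl n) (1 / (2 * n) : ℝ) hs)
  let A : Eucl n ≃L[ℝ] Eucl n := A₀.toContinuousLinearEquiv
  have hA : ∀ z, A z = (1 / (2 * n) : ℝ) • ∑ i, z i • β i := by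
    intro z
    change A₀ z = _
    simp only [A₀, LinearEquiv.trans_apply, Module.Basis.equivFun_symm_apply,
      WithLp.linearEquiv_apply, LinearEquiv.smulOfNeZero_apply]
    rfl
  let b' : Eucl n := (1 / (2 * n) : ℝ) • ∑ i, β i
  refine ⟨A, x₀ + b', fun z hz => ?_, fun y hy => ?_⟩
  · have hz1 : ∀ i, |z i| ≤ 1 := fun i => (PiLp.norm_apply_le z i).trans hz
    have heq : x₀ + b' + A z = x₀ + ∑ i, (1 / n : ℝ) • (((1 + z i) / 2) • β i + (1 - (1 + z i) / 2) • (0 : Eucl n)) := by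
      rw [hA, add_assoc]
      congr 1
      simp only [b']
      rw [← smul_add, ← Finset.sum_add_distrib, Finset.smul_sum]
      refine Finset.sum_congr rfl fun i _ => ?_
      rw [smul_zero, add_zero, smul_smul]
      rw [show β i + z i • β i = (1 + z i) • β i by rw [add_smul, one_smul], smul_smul]
      congr 1
      field_simp
    rw [heq]
    have hKc : Convex ℝ ((fun y => x₀ + y) ⁻¹' Z) := hZc.translate_preimage_right x₀
    refine hKc.sum_mem (fun i _ => by positivity) (by simp [hn'.ne']) fun i _ => ?_
    have := abs_le.1 (hz1 i)
    exact hKc (hβ i) (interior_subset h0) (by linarith) (by linarith) (by ring)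
  · have hy' : y - x₀ ∈ (fun y => x₀ + y) ⁻¹' Z := by simpa using hy
    have h1 := hcoord _ hy'
    let w : Eucl n := WithLp.toLp 2 fun i => 2 * n * β.repr (y - x₀) i - 1
    have hw : A w = y - (x₀ + b') := by
      rw [hA, ← sub_sub, Finset.smul_sum]
      conv_rhs => rw [← β.sum_repr (y - x₀)]
      simp only [b']
      rw [Finset.smul_sum, ← Finset.sum_sub_distrib]
      refine Finset.sum_congr rfl fun i _ => ?_
      rw [smul_smul, ← sub_smul]
      congr 1
      simp only [w]
      field_simp
    rw [← hw, A.symm_apply_apply]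
    have h2 : ‖w‖ ≤ ∑ _i : Fin n, (4 * n : ℝ) := by
      have h3 : ‖w‖ ≤ ∑ i, ‖w i‖ := by
        conv_lhs => rw [← (EuclideanSpace.basisFun (Fin n) ℝ).sum_repr w]
        refine (norm_sum_le _ _).trans (Finset.sum_le_sum fun i _ => ?_)
        rw [norm_smul, OrthonormalBasis.norm_eq_one, mul_one]
        rfl
      refine h3.trans (Finset.sum_le_sum fun i _ => ?_)
      rw [Real.norm_eq_abs]
      simp only [w]
      have := abs_le.1 (h1 i)
      rw [abs_le]
      constructor <;> nlinarith
    simp only [Finset.sum_const, Finset.card_univ, Fintype.card_fin, nsmul_eq_mul] at h2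
    rw [ellRatio]
    linarith [h2, sq (n : ℝ)]

/-- The section `{v ≤ a + ⟪k, ·⟫}` of `v`. -/
def affSec {n : ℕ} (Ω : Set (Eucl n)) (v : Eucl n → ℝ) (a : ℝ) (k : Eucl n) : Set (Eucl n) :=
  {y ∈ Ω | v y ≤ a + ⟪k, y⟫}

section Sections

variable {n : ℕ} {Ω : Set (Eucl n)} {v : Eucl n → ℝ} {a : ℝ} {k : Eucl n}

theorem convexOn_sub_affine (hv : ConvexOn ℝ Ω v) (a : ℝ) (k : Eucl n) :
    ConvexOn ℝ Ω (fun y => v y - (a + ⟪k, y⟫)) := by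
  refine ⟨hv.1, fun x hx y hy s t hs ht hst => ?_⟩
  have h := hv.2 hx hy hs ht hst
  simp only [inner_add_right, inner_smul_right, smul_eq_mul] at h ⊢
  have : a = s * a + t * a := by rw [← add_mul, hst, one_mul]
  nlinarith

theorem continuousOn_sub_affine (hv : ContinuousOn v Ω) (a : ℝ) (k : Eucl n) :
    ContinuousOn (fun y => v y - (a + ⟪k, y⟫)) Ω := by
  refine hv.sub (Continuous.continuousOn ?_)
  fun_prop

theorem convex_affSec (hv : ConvexOn ℝ Ω v) : Convex ℝ (affSec Ω v a k) := by
  have h := (convexOn_sub_affine hv a k).convex_le 0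
  simpa only [affSec, sub_nonpos] using h

theorem isCompact_affSec (hv : ContinuousOn v Ω) (hc : IsCompact {x ∈ Ω | v x ≤ 1})
    (hsub : ∀ y ∈ Ω, v y ≤ a + ⟪k, y⟫ → v y ≤ 1) : IsCompact (affSec Ω v a k) := by
  have h := ((continuousOn_sub_affine hv a k).mono
    (fun x hx => hx.1 : {x ∈ Ω | v x ≤ 1} ⊆ Ω)).preimage_isClosed_of_isClosed hc.isClosed isClosed_Iic
    (t := Iic 0)
  have heq : affSec Ω v a k = {x ∈ Ω | v x ≤ 1} ∩ (fun y => v y - (a + ⟪k, y⟫)) ⁻¹' Iic 0 := by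
    ext y
    simp only [affSec, mem_ofPred_eq, mem_inter_iff, mem_preimage, mem_Iic, sub_nonpos]
    exact ⟨fun ⟨h1, h2⟩ => ⟨⟨h1, hsub y h1 h2⟩, h2⟩, fun ⟨⟨h1, _⟩, h2⟩ => ⟨h1, h2⟩⟩
  rw [heq]
  exact hc.of_isClosed_subset h inter_subset_left

theorem mem_interior_affSec (hΩ : IsOpen Ω) (hv : ContinuousOn v Ω) {x : Eucl n} (hx : x ∈ Ω)
    (hlt : v x < a + ⟪k, x⟫) : x ∈ interior (affSec Ω v a k) := by
  have h := (continuousOn_sub_affine hv a k).isOpen_inter_preimage hΩ (isOpen_Iio (a := (0 : ℝ)))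
  refine mem_interior.2 ⟨_, fun y hy => ⟨hy.1, ?_⟩, h, hx, ?_⟩
  · have := hy.2
    simp only [mem_preimage, mem_Iio] at this
    linarith
  · simp only [mem_preimage, mem_Iio]
    linarith

theorem polar_subset_subgradImg (hΩ : IsOpen Ω) (hcont : ContinuousOn v Ω) (hv : ConvexOn ℝ Ω v)
    (hZ : IsCompact (affSec Ω v a k)) {x : Eucl n} (hx : x ∈ Ω) {u : ℝ} (hu : 0 < u)
    (hux : u = a + ⟪k, x⟫ - v x) :
    {p : Eucl n | ∀ y ∈ (fun y => y - x) '' affSec Ω v a k, ⟪p - k, y⟫ ≤ u} ⊆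
      subgradImg Ω v (affSec Ω v a k) := by
  intro p hp
  have hxZ : x ∈ affSec Ω v a k := ⟨hx, by linarith⟩
  have hZΩ : affSec Ω v a k ⊆ Ω := fun y hy => hy.1
  set g : Eucl n → ℝ := fun y => v y - (0 + ⟪p, y⟫) with hg
  have hgc : ContinuousOn g Ω := continuousOn_sub_affine hcont 0 p
  have hgv : ConvexOn ℝ Ω g := convexOn_sub_affine hv 0 p
  have hkey : ∃ z ∈ affSec Ω v a k, v z < a + ⟪k, z⟫ ∧ ∀ y ∈ affSec Ω v a k, g z ≤ g y := by
    obtain ⟨z, hz, hmin⟩ := hZ.exists_isMinOn ⟨x, hxZ⟩ (hgc.mono hZΩ)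
    by_cases h : v z < a + ⟪k, z⟫
    · exact ⟨z, hz, h, fun y hy => hmin hy⟩
    · refine ⟨x, hxZ, by linarith, fun y hy => le_trans ?_ (hmin hy)⟩
      have h1 := hp (z - x) ⟨z, hz, rfl⟩
      simp only [inner_sub_left, inner_sub_right] at h1
      simp only [hg]
      linarith
  obtain ⟨z, hz, hlt, hmin⟩ := hkey
  have hloc : IsLocalMinOn g Ω z := by
    have h1 : affSec Ω v a k ∈ nhds z :=
      mem_interior_iff_mem_nhds.1 (mem_interior_affSec hΩ hcont hz.1 hlt)
    exact Filter.Eventually.filter_mono nhdsWithin_le_nhds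
      (Filter.eventually_of_mem h1 fun y hy => hmin y hy)
  have hglob := IsMinOn.of_isLocalMinOn_of_convexOn hz.1 hloc hgv
  refine mem_iUnion₂.2 ⟨z, hz, fun y hy => ?_⟩
  have := hglob hy
  simp only [mem_ofPred_eq, hg] at this
  rw [inner_sub_right]
  linarith

theorem volume_subgradImg_le_of_thick {A : Eucl n ≃L[ℝ] Eucl n} {s M : ℝ} (hs : 0 < s) (hM : 0 ≤ M)
    {E : Set (Eucl n)} (hE : ∀ x ∈ E, a + ⟪k, x⟫ - v x ≤ M ∧
      ∀ z, ‖z‖ ≤ 1 → x + s • A z ∈ affSec Ω v a k) :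
    volume (subgradImg Ω v E) ≤ ENNReal.ofReal ((absDet A)⁻¹ * (M / s) ^ n * ballVol n) := by
  refine volume_polar_le A (by positivity) k fun p hp z hz => ?_
  obtain ⟨x, hxE, hpx⟩ := mem_iUnion₂.1 hp
  obtain ⟨h1, h2⟩ := hE x hxE
  have h3 := h2 z hz
  have h4 := hpx _ h3.1
  have h5 := h3.2
  rw [add_sub_cancel_left, inner_smul_right] at h4
  rw [inner_add_right, inner_smul_right] at h5
  rw [inner_sub_left, le_div_iff₀ hs]
  nlinarith

end Sections

section Solution

variable {n : ℕ} {q lam Lam : ℝ} {Ω : Set (Eucl n)} {v : Eucl n → ℝ}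

theorem GenSol.volume_subgradImg_le (hsol : GenSol n q lam Lam Ω v) (hq : 0 < q) (hLam : 0 ≤ Lam)
    {E : Set (Eucl n)} (hE : MeasurableSet E) (hEΩ : E ⊆ Ω) {m B : ℝ} (hm : 0 ≤ m)
    (hvm : ∀ x ∈ E, v x ≤ m) (hB : volume E ≤ ENNReal.ofReal B) :
    volume (subgradImg Ω v E) ≤ ENNReal.ofReal (Lam * (m ^ q * B)) := by
  refine (hsol.2.2.2.1 E hE hEΩ).trans ?_
  rw [ENNReal.ofReal_mul hLam, ENNReal.ofReal_mul (by positivity)]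
  gcongr
  calc ∫⁻ x in E ∩ {x | 0 < v x}, ENNReal.ofReal (v x ^ q)
      ≤ ∫⁻ x in E, ENNReal.ofReal (v x ^ q) := lintegral_mono_set inter_subset_left
    _ ≤ ∫⁻ _ in E, ENNReal.ofReal (m ^ q) := by
        refine setLIntegral_mono' hE fun x hx => ?_
        have := hsol.2.2.1 x (hEΩ hx)
        gcongr
        exact hvm x hx
    _ = ENNReal.ofReal (m ^ q) * volume E := by simp
    _ ≤ _ := by gcongr

theorem GenSol.le_volume_subgradImg (hsol : GenSol n q lam Lam Ω v) (hq : 0 < q) (hlam : 0 ≤ lam)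
    {E : Set (Eucl n)} (hE : MeasurableSet E) (hEΩ : E ⊆ Ω) {m : ℝ} (hm : 0 < m)
    (hvm : ∀ x ∈ E, m ≤ v x) :
    ENNReal.ofReal (lam * m ^ q) * volume E ≤ volume (subgradImg Ω v E) := by
  have heq : E ∩ {x | 0 < v x} = E := inter_eq_left.2 fun x hx => hm.trans_le (hvm x hx)
  have h := hsol.2.2.2.2 E hE hEΩ
  rw [heq] at h
  refine le_trans ?_ h
  rw [ENNReal.ofReal_mul hlam, mul_assoc]
  gcongr
  calc ENNReal.ofReal (m ^ q) * volume E = ∫⁻ _ in E, ENNReal.ofReal (m ^ q) := by simp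
    _ ≤ _ := by
        refine setLIntegral_mono' hE fun x hx => ?_
        gcongr
        exact hvm x hx

end Solution

theorem half_le_of_halving_step {n : ℕ} (hn : 0 < n) {q lam C : ℝ} (hq : q < n) (hlam : 0 < lam)
    (hC : 0 < C) :
    ∃ B : ℝ, 0 < B ∧ ∀ F : ℝ → ℝ, (∀ t, 0 ≤ F t) → (∀ s t, s ≤ t → t ≤ 1 → F s ≤ F t) →
      (∀ t ∈ Ioc (0 : ℝ) 1, ∀ ε ∈ Ioo (0 : ℝ) 1,
        lam * (t / 2) ^ q * (F t * (F t * (1 - n * ε) - F (t / 2))) ≤ (t / ε) ^ n * C) →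
      ∀ t ∈ Ioc (0 : ℝ) 1, B * t ^ (n - q) < F t ^ 2 → ∀ k : ℕ, F t / 2 ≤ F (t / 2 ^ k) := by
  set σ : ℝ := 2 ^ (n - q) with hσ
  have hσ1 : 1 < σ := Real.one_lt_rpow one_lt_two (by linarith)
  have hσ0 : 0 < σ := by linarith
  set τ : ℝ := σ⁻¹ ^ ((n + 1 : ℝ)⁻¹) with hτ
  have hτ0 : 0 < τ := by positivity
  have hτ1 : τ < 1 := Real.rpow_lt_one (by positivity) (inv_lt_one_of_one_lt₀ hσ1) (by positivity)
  have hτp : τ ^ (n + 1) = σ⁻¹ := by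
    rw [hτ]
    have := Real.rpow_inv_natCast_pow (n := n + 1) (x := σ⁻¹) (by positivity) (by omega)
    push_cast at this
    exact this
  have hn' : (1 : ℝ) ≤ n := by exact_mod_cast hn
  set ε₀ : ℝ := (1 - τ) / (4 * n) with hε₀
  have hε0 : 0 < ε₀ := div_pos (by linarith) (by linarith)
  have hε1 : ε₀ < 1 := by
    rw [hε₀, div_lt_one (by linarith)]; linarith
  have hnε : n * ε₀ = (1 - τ) / 4 := by rw [hε₀]; field_simp
  set C' : ℝ := C * 2 ^ q / lam with hC'
  have hC'0 : 0 < C' := by positivity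
  have h1τ : 0 < 1 - τ := by linarith
  refine ⟨8 * C' / (ε₀ ^ n * (1 - τ)), by positivity, fun F hF hmono hstep t ht hbig => ?_⟩
  have ht0 := ht.1
  set P := F t with hP
  have hP0 : 0 < P := by
    refine lt_of_le_of_ne (hF t) fun h => ?_
    rw [← h] at hbig
    have : 0 < 8 * C' / (ε₀ ^ n * (1 - τ)) * t ^ (n - q) := by positivity
    nlinarith
  suffices h : ∀ k : ℕ, P * (1 - (1 / 2) * (1 - τ ^ k)) ≤ F (t / 2 ^ k) by
    intro k
    refine le_trans ?_ (h k)
    have := pow_pos hτ0 k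
    nlinarith
  intro k
  induction k with
  | zero => simp [hP]
  | succ k ih =>
    set s := t / 2 ^ k with hs
    have hs0 : 0 < s := by positivity
    have hst : s ≤ t := div_le_self ht0.le (one_le_pow₀ (by norm_num))
    have hs1 : s ≤ 1 := hst.trans ht.2
    set x := F s with hx
    have hxP : x ≤ P := hmono s t hst ht.2
    have hτk := pow_pos hτ0 k
    have hτk1 : τ ^ k ≤ 1 := pow_le_one₀ hτ0.le hτ1.le
    have hPx : P / 2 ≤ x := by
      refine le_trans ?_ ih
      nlinarith
    have hx0 : 0 < x := by linarith
    have hεk : ε₀ * τ ^ k ∈ Ioo (0 : ℝ) 1 := ⟨by positivity, by nlinarith⟩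
    have h1 := hstep s ⟨hs0, hs1⟩ _ hεk
    have hnext : t / 2 ^ (k + 1) = s / 2 := by rw [hs, pow_succ]; field_simp
    rw [hnext]
    set y := F (s / 2) with hy
    have hspow : s ^ n = s ^ q * (t ^ (n - q) * (τ ^ (n + 1)) ^ k) := by
      have e1 : s ^ n = s ^ q * s ^ ((n : ℝ) - q) := by
        rw [← Real.rpow_add hs0, ← Real.rpow_natCast]; congr 1; ring
      have e2 : s ^ ((n : ℝ) - q) = t ^ ((n : ℝ) - q) * (τ ^ (n + 1)) ^ k := by
        rw [hs, Real.div_rpow ht0.le (by positivity), hτp, hσ, inv_pow, div_eq_mul_inv]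
        congr 2
        rw [← Real.rpow_natCast, ← Real.rpow_mul two_pos.le, ← Real.rpow_natCast,
          ← Real.rpow_mul two_pos.le, mul_comm]
      rw [e1, e2]
    have h2 : x * (x * (1 - n * (ε₀ * τ ^ k)) - y) ≤ C' * t ^ ((n : ℝ) - q) * τ ^ k / ε₀ ^ n := by
      have e3 : (s / (ε₀ * τ ^ k)) ^ n * C
          = lam * (s / 2) ^ q * (C' * t ^ ((n : ℝ) - q) * τ ^ k / ε₀ ^ n) := by
        rw [div_pow, hspow, Real.div_rpow hs0.le two_pos.le, hC', mul_pow]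
        have : (τ ^ (n + 1)) ^ k = (τ ^ k) ^ n * τ ^ k := by ring
        rw [this]
        field_simp
      rw [e3] at h1
      exact le_of_mul_le_mul_left h1 (by positivity)
    have h3 : C' * t ^ ((n : ℝ) - q) * τ ^ k / ε₀ ^ n ≤ (1 - τ) / 8 * τ ^ k * P ^ 2 := by
      have h4 : 8 * C' / (ε₀ ^ n * (1 - τ)) * t ^ ((n : ℝ) - q)
          = (C' * t ^ ((n : ℝ) - q) * τ ^ k / ε₀ ^ n) * (8 / ((1 - τ) * τ ^ k)) := by
        field_simp
      rw [h4] at hbig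
      have h5 : 0 < 8 / ((1 - τ) * τ ^ k) := by positivity
      have h6 := (lt_div_iff₀ h5).2 hbig
      refine h6.le.trans (le_of_eq ?_)
      field_simp
    have h7 : x * (1 - n * (ε₀ * τ ^ k)) - y ≤ (1 - τ) / 4 * τ ^ k * P := by
      by_contra! hcon
      have : x * ((1 - τ) / 4 * τ ^ k * P) < x * (x * (1 - n * (ε₀ * τ ^ k)) - y) := by gcongr
      have h8 : (1 - τ) / 8 * τ ^ k * P ^ 2 ≤ x * ((1 - τ) / 4 * τ ^ k * P) := by
        have : 0 ≤ (1 - τ) / 4 * τ ^ k * P := by positivity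
        nlinarith
      linarith
    have h9 : x * (n * (ε₀ * τ ^ k)) ≤ (1 - τ) / 4 * τ ^ k * P := by
      have : n * (ε₀ * τ ^ k) = (1 - τ) / 4 * τ ^ k := by rw [← mul_assoc, hnε]
      rw [this]
      calc x * ((1 - τ) / 4 * τ ^ k) = (1 - τ) / 4 * τ ^ k * x := by ring
        _ ≤ (1 - τ) / 4 * τ ^ k * P := by gcongr
    rw [pow_succ]
    have e4 : P * (1 - 1 / 2 * (1 - τ ^ k * τ))
        = P * (1 - 1 / 2 * (1 - τ ^ k)) - 2 * ((1 - τ) / 4 * τ ^ k * P) := by ring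
    have e5 : x * (1 - n * (ε₀ * τ ^ k)) = x - x * (n * (ε₀ * τ ^ k)) := by ring
    linarith

section Volume

variable {n : ℕ} {q lam Lam : ℝ} {Ω : Set (Eucl n)} {v : Eucl n → ℝ}

theorem affSec_zero_right (t : ℝ) : affSec Ω v t 0 = {x ∈ Ω | v x ≤ t} := by
  ext y; simp [affSec]

theorem volume_real_le_of_subset_ellipsoid {Z : Set (Eucl n)} {A : Eucl n ≃L[ℝ] Eucl n}
    {b : Eucl n} {R : ℝ} (hR : 0 ≤ R) (h : ∀ y ∈ Z, ‖A.symm (y - b)‖ ≤ R) :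
    volume Z ≤ ENNReal.ofReal (absDet A * R ^ n * ballVol n) := by
  rw [← volume_ellipsoid A b hR]
  refine measure_mono fun y hy => ⟨A.symm (y - b), by simpa using h y hy, by simp⟩

theorem GenSol.sublevel_step (hn : 0 < n) (hq : 0 < q) (hlam : 0 < lam) (hΩ : IsOpen Ω)
    (hsol : GenSol n q lam Lam Ω v) (h0 : coin Ω v = {0}) (hc : IsCompact {x ∈ Ω | v x ≤ 1})
    {t : ℝ} (ht : t ∈ Ioc (0 : ℝ) 1) {ε : ℝ} (hε : ε ∈ Ioo (0 : ℝ) 1) :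
    lam * (t / 2) ^ q * (volume.real {x ∈ Ω | v x ≤ t} * (volume.real {x ∈ Ω | v x ≤ t} *
      (1 - n * ε) - volume.real {x ∈ Ω | v x ≤ t / 2})) ≤
      (t / ε) ^ n * (ellRatio n ^ n * ballVol n ^ 2) := by
  have h0Ω : (0 : Eucl n) ∈ coin Ω v := by rw [h0]; rfl
  have hcont := hsol.1
  have hconv := hsol.2.1
  have ht0 := ht.1
  have hε0 := hε.1
  have hε1 := hε.2
  have hsub : ∀ s ≤ 1, ∀ y ∈ Ω, v y ≤ s + ⟪(0 : Eucl n), y⟫ → v y ≤ 1 := by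
    intro s hs y _ hy
    simp only [inner_zero_left, add_zero] at hy
    exact hy.trans hs
  have hZ : IsCompact (affSec Ω v t 0) := isCompact_affSec hcont hc (hsub t ht.2)
  have hZ2 : IsCompact (affSec Ω v (t / 2) 0) := isCompact_affSec hcont hc (hsub _ (by linarith [ht.2]))
  have hZc : Convex ℝ (affSec Ω v t 0) := convex_affSec hconv
  obtain ⟨A, b, hA1, hA2⟩ := exists_ellipsoid hn hZ hZc
    ⟨0, mem_interior_affSec hΩ hcont h0Ω.1 (by rw [h0Ω.2]; simpa using ht0)⟩
  rw [← affSec_zero_right, ← affSec_zero_right]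
  set Z := affSec Ω v t 0 with hZdef
  set Z₂ := affSec Ω v (t / 2) 0 with hZ₂def
  set E₀ := (fun y => (ε • b) + ((1 - ε) • LinearMap.id : Eucl n →ₗ[ℝ] Eucl n) y) '' Z with hE₀
  have hbZ : b ∈ Z := by simpa using hA1 0 (by simp)
  have hE₀Z : E₀ ⊆ Z := by
    rintro _ ⟨y, hy, rfl⟩
    exact hZc hbZ hy hε0.le (by linarith) (by ring)
  have hZΩ : Z ⊆ Ω := fun y hy => hy.1
  have hE₀c : IsCompact E₀ := hZ.image (by
    simp only [LinearMap.smul_apply, LinearMap.id_apply]; fun_prop)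
  set E := E₀ ∩ v ⁻¹' Ici (t / 2) with hE
  have hEm : MeasurableSet E :=
    ((hcont.mono (hE₀Z.trans hZΩ)).preimage_isClosed_of_isClosed hE₀c.isClosed
      isClosed_Ici).measurableSet
  have hEΩ : E ⊆ Ω := inter_subset_left.trans (hE₀Z.trans hZΩ)
  have hEfin : volume E ≠ ⊤ :=
    ((measure_mono (inter_subset_left.trans hE₀Z)).trans_lt hZ.measure_lt_top).ne
  have hlow := hsol.le_volume_subgradImg hq hlam.le hEm hEΩ (m := t / 2) (by linarith)
    fun x hx => hx.2
  have hup := volume_subgradImg_le_of_thick (Ω := Ω) (v := v) (a := t) (k := 0) (A := A) hε0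
    ht0.le (E := E) (by
      rintro _ ⟨⟨y, hy, rfl⟩, hx⟩
      refine ⟨?_, fun z hz => ?_⟩
      · have := hsol.2.2.1 _ (hZΩ (hE₀Z ⟨y, hy, rfl⟩))
        simp only [inner_zero_left]
        linarith
      · have := hZc (hA1 z hz) hy hε0.le (by linarith) (by ring : ε + (1 - ε) = 1)
        convert this using 1
        simp only [LinearMap.smul_apply, LinearMap.id_apply, smul_add]
        abel)
  have hvolZ := volume_real_le_of_subset_ellipsoid (by rw [ellRatio]; positivity) hA2
  have hD := absDet_pos A
  have hω := ballVol_pos n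
  have hRn : 0 ≤ ellRatio n := by rw [ellRatio]; positivity
  have e1 : lam * (t / 2) ^ q * volume.real E ≤ (absDet A)⁻¹ * (t / ε) ^ n * ballVol n := by
    have h := hlow.trans hup
    rw [← ENNReal.ofReal_toReal hEfin, ← ENNReal.ofReal_mul (by positivity)] at h
    exact (ENNReal.ofReal_le_ofReal_iff (by positivity)).1 h
  have e2 : volume.real Z ≤ absDet A * ellRatio n ^ n * ballVol n :=
    ENNReal.toReal_le_of_le_ofReal (by positivity) hvolZ
  have e3 : (1 - n * ε) * volume.real Z ≤ volume.real E + volume.real Z₂ := by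
    have h1 : volume.real E₀ = (1 - ε) ^ n * volume.real Z := by
      rw [Measure.real, hE₀, volume_image_affine]
      simp only [LinearMap.det_smul, LinearMap.det_id, mul_one, finrank_euclideanSpace_fin,
        ENNReal.toReal_mul]
      rw [abs_of_nonneg (pow_nonneg (by linarith) n), ENNReal.toReal_ofReal
        (pow_nonneg (by linarith) n)]
      rfl
    have h2 : E₀ ⊆ E ∪ Z₂ := by
      intro x hx
      by_cases h : t / 2 ≤ v x
      · exact Or.inl ⟨hx, h⟩
      · refine Or.inr ⟨hZΩ (hE₀Z hx), ?_⟩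
        simp only [inner_zero_left]; linarith
    have h3 : volume.real E₀ ≤ volume.real E + volume.real Z₂ :=
      (measureReal_mono h2 (measure_union_lt_top hEfin.lt_top hZ2.measure_lt_top).ne).trans
        (measureReal_union_le _ _)
    have h4 : 1 - n * ε ≤ (1 - ε) ^ n := by
      have := one_add_mul_le_pow (a := -ε) (by linarith) n
      calc 1 - n * ε = 1 + n * (-ε) := by ring
        _ ≤ (1 + -ε) ^ n := this
        _ = _ := by ring
    calc (1 - n * ε) * volume.real Z ≤ (1 - ε) ^ n * volume.real Z := by gcongr
      _ ≤ _ := by rw [← h1]; exact h3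
  have hF : 0 ≤ volume.real Z := measureReal_nonneg
  have hEr : 0 ≤ volume.real E := measureReal_nonneg
  have hq2 : 0 ≤ lam * (t / 2) ^ q := by positivity
  calc lam * (t / 2) ^ q * (volume.real Z * (volume.real Z * (1 - n * ε) - volume.real Z₂))
      ≤ lam * (t / 2) ^ q * (volume.real Z * volume.real E) := by
        gcongr; linarith
    _ = lam * (t / 2) ^ q * volume.real E * volume.real Z := by ring
    _ ≤ ((absDet A)⁻¹ * (t / ε) ^ n * ballVol n) * (absDet A * ellRatio n ^ n * ballVol n) := by
        gcongr
    _ = _ := by field_simp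

/-- The volume of the sublevel sets of a solution with a one-point coincidence set. -/
theorem exists_sublevel_volume_le (hn : 0 < n) (hq : 0 < q) (hqn : q < n) (hlam : 0 < lam) :
    ∃ B : ℝ, 0 < B ∧ ∀ (Lam : ℝ) (Ω : Set (Eucl n)) (v : Eucl n → ℝ), IsOpen Ω →
      GenSol n q lam Lam Ω v → coin Ω v = {0} → IsCompact {x ∈ Ω | v x ≤ 1} →
      ∀ t ∈ Ioc (0 : ℝ) 1, volume.real {x ∈ Ω | v x ≤ t} ^ 2 ≤ B * t ^ (n - q) := by
  have hR : 0 < ellRatio n := by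
    have : (0 : ℝ) < n := by exact_mod_cast hn
    rw [ellRatio]; positivity
  have hω := ballVol_pos n
  obtain ⟨B, hB, hhalf⟩ := half_le_of_halving_step hn hqn hlam
    (C := ellRatio n ^ n * ballVol n ^ 2) (by positivity)
  refine ⟨B, hB, fun Lam Ω v hΩ hsol h0 hc t ht => ?_⟩
  by_contra! hbig
  have hcomp : ∀ s ≤ (1 : ℝ), IsCompact {x ∈ Ω | v x ≤ s} := by
    intro s hs
    rw [← affSec_zero_right]
    refine isCompact_affSec hsol.1 hc fun y _ hy => ?_
    simp only [inner_zero_left, add_zero] at hy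
    exact hy.trans hs
  have hlow := hhalf (fun t => volume.real {x ∈ Ω | v x ≤ t}) (fun _ => measureReal_nonneg)
    (fun s t hst ht1 => measureReal_mono (fun x hx => ⟨hx.1, hx.2.trans hst⟩)
      (hcomp t ht1).measure_lt_top.ne)
    (fun t ht ε hε => hsol.sublevel_step hn hq hlam hΩ h0 hc ht hε) t ht hbig
  have hts : ∀ k : ℕ, t / 2 ^ k ≤ 1 := fun k =>
    (div_le_self ht.1.le (one_le_pow₀ (by norm_num))).trans ht.2
  have hanti : Antitone fun k : ℕ => {x ∈ Ω | v x ≤ t / 2 ^ k} := by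
    intro i j hij x hx
    refine ⟨hx.1, hx.2.trans ?_⟩
    have := ht.1.le
    gcongr
    norm_num
  have hinter : ⋂ k : ℕ, {x ∈ Ω | v x ≤ t / 2 ^ k} = {0} := by
    rw [← h0]
    ext x
    simp only [mem_iInter, mem_ofPred_eq, coin]
    constructor
    · intro h
      refine ⟨(h 0).1, le_antisymm ?_ (hsol.2.2.1 x (h 0).1)⟩
      have hlim : Filter.Tendsto (fun k : ℕ => t / 2 ^ k) Filter.atTop (nhds 0) :=
        tendsto_const_nhds.div_atTop (tendsto_pow_atTop_atTop_of_one_lt one_lt_two)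
      exact ge_of_tendsto' hlim fun k => (h k).2
    · rintro ⟨hx, hx0⟩ k
      refine ⟨hx, ?_⟩
      rw [hx0]
      have := ht.1.le
      positivity
  have hlim := tendsto_measure_iInter_atTop (μ := (volume : Measure (Eucl n)))
    (fun k => ((hcomp _ (hts k)).isClosed.measurableSet.nullMeasurableSet)) hanti
    ⟨0, (hcomp _ (hts 0)).measure_lt_top.ne⟩
  rw [hinter] at hlim
  have : Nonempty (Fin n) := ⟨⟨0, hn⟩⟩
  rw [measure_singleton] at hlim
  have hpos : 0 < volume.real {x ∈ Ω | v x ≤ t} := by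
    refine lt_of_le_of_ne measureReal_nonneg fun h => ?_
    rw [← h] at hbig
    have : 0 < B * t ^ (n - q) := mul_pos hB (Real.rpow_pos_of_pos ht.1 _)
    nlinarith
  have hge : ENNReal.ofReal (volume.real {x ∈ Ω | v x ≤ t} / 2) ≤ 0 := by
    refine ge_of_tendsto' hlim fun k => ?_
    have h1 := hlow k
    exact ENNReal.ofReal_le_of_le_toReal h1
  have := ENNReal.ofReal_pos.2 (half_pos hpos)
  exact absurd hge (not_le.2 this)

end Volume

section Sections

variable {n : ℕ} {q lam Lam : ℝ} {Ω : Set (Eucl n)} {v : Eucl n → ℝ}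

theorem ellRatio_pos (hn : 0 < n) : 0 < ellRatio n := by
  have : (0 : ℝ) < n := by exact_mod_cast hn
  rw [ellRatio]; positivity

theorem affine_le_of_nonneg_on_ellipsoid {A : Eucl n ≃L[ℝ] Eucl n} {b k : Eucl n} {a R : ℝ}
    (hR : 0 < R) (h : ∀ z, ‖z‖ ≤ 1 → 0 ≤ a + ⟪k, b + A z⟫) {z : Eucl n} (hz : ‖z‖ ≤ R) :
    |⟪k, A z⟫| ≤ R * (a + ⟪k, b⟫) := by
  have hz' : ‖R⁻¹ • z‖ ≤ 1 := by
    rw [norm_smul, Real.norm_of_nonneg (by positivity), inv_mul_le_iff₀ hR]; simpa using hz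
  have h1 := h _ hz'
  have h2 := h (-(R⁻¹ • z)) (by rwa [norm_neg])
  simp only [map_neg, map_smul, inner_add_right, inner_neg_right, inner_smul_right] at h1 h2
  have e : ⟪k, A z⟫ = R * (R⁻¹ * ⟪k, A z⟫) := by field_simp
  rw [e, abs_mul, abs_of_pos hR]
  refine mul_le_mul_of_nonneg_left (abs_le.2 ⟨?_, ?_⟩) hR.le <;> linarith

/-- The subdifferential image of a section of height at most `M` has volume at most a multiple of
`M ^ n` divided by the volume of the section. -/
theorem exists_volume_subgradImg_affSec_le (hn : 0 < n) (hq : 0 < q) (hqn : q < n) (hlam : 0 < lam)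
    (hlL : lam ≤ Lam) :
    ∃ G : ℝ, 0 < G ∧ ∀ (Ω : Set (Eucl n)) (v : Eucl n → ℝ), IsOpen Ω →
      GenSol n q lam Lam Ω v → coin Ω v = {0} → IsCompact {x ∈ Ω | v x ≤ 1} →
      ∀ (a : ℝ) (k : Eucl n) (M : ℝ), 0 < M → (∀ y ∈ Ω, v y ≤ a + ⟪k, y⟫ → v y ≤ 1) →
      (∀ y ∈ Ω, a + ⟪k, y⟫ - v y ≤ M) → ∀ (A : Eucl n ≃L[ℝ] Eucl n) (b : Eucl n),
      (∀ z, ‖z‖ ≤ 1 → b + A z ∈ affSec Ω v a k) →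
      (∀ y ∈ affSec Ω v a k, ‖A.symm (y - b)‖ ≤ ellRatio n) →
      volume (subgradImg Ω v (affSec Ω v a k)) ≤ ENNReal.ofReal ((absDet A)⁻¹ * (G * M ^ n)) := by
  obtain ⟨B, hB, hvol⟩ := exists_sublevel_volume_le hn hq hqn hlam
  have hLam : 0 < Lam := hlam.trans_le hlL
  have hR := ellRatio_pos hn
  have hω := ballVol_pos n
  set R := ellRatio n with hRdef
  set ω := ballVol n with hωdef
  set G₁ : ℝ := Lam * (1 + R) ^ q * R ^ n * ω * (4 ^ q * 4 ^ n / lam) with hG₁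
  set G₂ : ℝ := Lam * B * (4 * (1 + R)) ^ n / ω with hG₂
  have hG₁0 : 0 < G₁ := by positivity
  have hG₂0 : 0 < G₂ := by positivity
  refine ⟨G₁ + G₂, by positivity, fun Ω v hΩ hsol h0 hc a k M hM hsub hMle A b hA1 hA2 => ?_⟩
  set Z := affSec Ω v a k with hZ
  have hZc : IsCompact Z := isCompact_affSec hsol.1 hc hsub
  have hZΩ : Z ⊆ Ω := fun y hy => hy.1
  have hD := absDet_pos A
  set D := absDet A with hDdef
  have hbZ : b ∈ Z := by simpa using hA1 0 (by simp)
  set l := a + ⟪k, b⟫ with hl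
  have hnn : ∀ z, ‖z‖ ≤ 1 → 0 ≤ a + ⟪k, b + A z⟫ := fun z hz =>
    (hsol.2.2.1 _ (hZΩ (hA1 z hz))).trans (hA1 z hz).2
  have hl0 : 0 ≤ l := by simpa using hnn 0 (by simp)
  have hvZ : ∀ y ∈ Z, v y ≤ (1 + R) * l := by
    intro y hy
    have h1 := (abs_le.1 (affine_le_of_nonneg_on_ellipsoid hR hnn (hA2 y hy))).2
    have h2 := hy.2
    have e : ⟪k, y⟫ = ⟪k, b⟫ + ⟪k, A (A.symm (y - b))⟫ := by
      rw [← inner_add_right]; simp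
    rw [e] at h2
    linarith
  have hZvol := volume_real_le_of_subset_ellipsoid hR.le hA2
  rcases le_or_gt (4 * M) l with hcase | hcase
  · set E := (fun z => b + A z) '' closedBall 0 (1 / 2) with hE
    have hEc : IsCompact E := (isCompact_closedBall _ _).image (by fun_prop)
    have hEZ : ∀ x ∈ E, a + ⟪k, x⟫ - v x ≤ M ∧ ∀ z, ‖z‖ ≤ 1 → x + (1 / 2 : ℝ) • A z ∈ Z := by
      rintro _ ⟨y, hy, rfl⟩
      rw [mem_closedBall_zero_iff] at hy
      refine ⟨hMle _ (hZΩ (hA1 y (by linarith))), fun z hz => ?_⟩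
      have : ‖y + (1 / 2 : ℝ) • z‖ ≤ 1 := by
        refine (norm_add_le _ _).trans ?_
        rw [norm_smul, Real.norm_of_nonneg (by norm_num)]
        linarith
      have h := hA1 _ this
      rwa [map_add, map_smul, ← add_assoc] at h
    have hEsub : E ⊆ Ω := fun x hx => by
      have := ((hEZ x hx).2 0 (by simp)).1
      simpa using this
    have hEv : ∀ x ∈ E, l / 4 ≤ v x := by
      intro x hx
      have h1 := (hEZ x hx).1
      obtain ⟨z, hz, rfl⟩ := hx
      rw [mem_closedBall_zero_iff] at hz
      have hz' : ‖(2 : ℝ) • z‖ ≤ 1 := by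
        rw [norm_smul, Real.norm_of_nonneg (by norm_num)]; linarith
      have h2 := (abs_le.1 (affine_le_of_nonneg_on_ellipsoid one_pos hnn hz')).1
      simp only [map_smul, inner_smul_right] at h2
      rw [inner_add_right] at h1
      linarith
    have h1 := (hsol.le_volume_subgradImg hq hlam.le hEc.isClosed.measurableSet hEsub
      (by linarith : 0 < l / 4) hEv).trans
        (volume_subgradImg_le_of_thick (A := A) (by norm_num : (0 : ℝ) < 1 / 2) hM.le hEZ)
    have h2 := hsol.volume_subgradImg_le hq hLam.le hZc.isClosed.measurableSet hZΩ
      (by positivity : 0 ≤ (1 + R) * l) hvZ hZvol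
    rw [hE, volume_ellipsoid A b (by norm_num), ← ENNReal.ofReal_mul (by positivity),
      ENNReal.ofReal_le_ofReal_iff (by positivity)] at h1
    refine h2.trans (ENNReal.ofReal_le_ofReal ?_)
    have h3 : l ^ q * D ^ 2 ≤ 4 ^ q * 4 ^ n / lam * M ^ n := by
      have e1 : lam * (l / 4) ^ q * (D * (1 / 2) ^ n * ω)
          = (l ^ q * D ^ 2) * (lam / 4 ^ q * (1 / 2) ^ n * ω / D) := by
        rw [Real.div_rpow hl0 (by norm_num)]; field_simp
      have e2 : D⁻¹ * (M / (1 / 2)) ^ n * ω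
          = (4 ^ q * 4 ^ n / lam * M ^ n) * (lam / 4 ^ q * (1 / 2) ^ n * ω / D) := by
        have : (M / (1 / 2)) ^ n = 4 ^ n * (1 / 2) ^ n * M ^ n := by
          rw [← mul_pow, ← mul_pow]; congr 1; ring
        rw [this]
        field_simp
      have : 0 < lam / 4 ^ q * (1 / 2) ^ n * ω / D := by positivity
      refine le_of_mul_le_mul_right ?_ this
      rw [← e1, ← e2]
      exact h1
    calc Lam * (((1 + R) * l) ^ q * (D * R ^ n * ω))
        = D⁻¹ * (Lam * (1 + R) ^ q * R ^ n * ω * (l ^ q * D ^ 2)) := by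
          rw [Real.mul_rpow (by positivity) hl0]; field_simp
      _ ≤ D⁻¹ * (Lam * (1 + R) ^ q * R ^ n * ω * (4 ^ q * 4 ^ n / lam * M ^ n)) := by gcongr
      _ = D⁻¹ * (G₁ * M ^ n) := by rw [hG₁]; ring
      _ ≤ _ := by gcongr; linarith
  · set m : ℝ := min (4 * (1 + R) * M) 1 with hm
    have hm0 : 0 < m := lt_min (by positivity) one_pos
    have hvm : ∀ y ∈ Z, v y ≤ m := by
      intro y hy
      refine le_min ((hvZ y hy).trans ?_) (hsub y hy.1 hy.2)
      nlinarith
    have hfin := hZc.measure_lt_top (μ := volume)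
    have h1 := hsol.volume_subgradImg_le hq hLam.le hZc.isClosed.measurableSet hZΩ hm0.le hvm
      (B := volume.real Z) (by rw [Measure.real, ENNReal.ofReal_toReal hfin.ne])
    have hmc : IsCompact {x ∈ Ω | v x ≤ m} := by
      rw [← affSec_zero_right]
      refine isCompact_affSec hsol.1 hc fun y _ hy => ?_
      simp only [inner_zero_left, add_zero] at hy
      exact hy.trans (min_le_right _ _)
    have h2 : volume.real Z ^ 2 ≤ B * m ^ (n - q) := by
      refine le_trans ?_ (hvol Lam Ω v hΩ hsol h0 hc m ⟨hm0, min_le_right _ _⟩)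
      have : volume.real Z ≤ volume.real {x ∈ Ω | v x ≤ m} :=
        measureReal_mono (fun y hy => ⟨hy.1, hvm y hy⟩) hmc.measure_lt_top.ne
      gcongr
    have h3 : D * ω ≤ volume.real Z := by
      have h := volume_ellipsoid A b zero_le_one
      rw [one_pow, mul_one] at h
      have h' : ENNReal.ofReal (D * ω) ≤ volume Z := by
        rw [← h]
        refine measure_mono ?_
        rintro _ ⟨z, hz, rfl⟩
        exact hA1 z (by simpa using hz)
      rw [Measure.real, ← ENNReal.toReal_ofReal (by positivity : 0 ≤ D * ω)]
      exact ENNReal.toReal_mono hfin.ne h'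
    refine h1.trans (ENNReal.ofReal_le_ofReal ?_)
    have hmM : m ^ n ≤ (4 * (1 + R)) ^ n * M ^ n := by
      rw [← mul_pow]
      exact pow_le_pow_left₀ hm0.le (min_le_left _ _) n
    have e3 : m ^ q * m ^ ((n : ℝ) - q) = m ^ n := by
      rw [← Real.rpow_add hm0, ← Real.rpow_natCast]; congr 1; ring
    calc Lam * (m ^ q * volume.real Z)
        = D⁻¹ * (Lam * m ^ q * ((D * ω) * volume.real Z) / ω) := by field_simp
      _ ≤ D⁻¹ * (Lam * m ^ q * (volume.real Z * volume.real Z) / ω) := by gcongr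
      _ ≤ D⁻¹ * (Lam * m ^ q * (B * m ^ ((n : ℝ) - q)) / ω) := by
          rw [← sq]; gcongr
      _ = D⁻¹ * (Lam * B * (m ^ q * m ^ ((n : ℝ) - q)) / ω) := by ring
      _ ≤ D⁻¹ * (Lam * B * ((4 * (1 + R)) ^ n * M ^ n) / ω) := by rw [e3]; gcongr
      _ = D⁻¹ * (G₂ * M ^ n) := by rw [hG₂]; ring
      _ ≤ _ := by gcongr; linarith

end Sections

/-- Points whose height in a section contained in `{v ≤ 1}` is a definite fraction of the height
of the section lie at definite relative depth in this section. -/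
def DeepSections {E : Type*} [NormedAddCommGroup E] [NormedSpace ℝ E] (Ω : Set E) (v : E → ℝ)
    (c : ℝ) : Prop :=
  ∀ (a : ℝ) (f : E →L[ℝ] ℝ) (M : ℝ), 0 < M → (∀ y ∈ Ω, v y ≤ a + f y → v y ≤ 1) →
    (∀ y ∈ Ω, a + f y - v y ≤ M) → ∀ x ∈ Ω, M / 32 ≤ a + f x - v x → ∀ w ∈ Ω, v w ≤ a + f w →
    x + c • (x - w) ∈ Ω ∧ v (x + c • (x - w)) ≤ a + f (x + c • (x - w))

theorem DeepSections.comp_symm {E F : Type*} [NormedAddCommGroup E] [NormedSpace ℝ E]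
    [NormedAddCommGroup F] [NormedSpace ℝ F] {Ω : Set E} {v : E → ℝ} {c : ℝ}
    (h : DeepSections Ω v c) (T : E ≃L[ℝ] F) :
    DeepSections (T '' Ω) (fun y => v (T.symm y)) c := by
  intro a f M hM h1 h2 x hx h3 w hw h4
  obtain ⟨x, hx, rfl⟩ := hx
  obtain ⟨w, hw, rfl⟩ := hw
  have h5 := h a (f.comp (T : E →L[ℝ] F)) M hM (fun y hy hv => by
      simpa using h1 (T y) (mem_image_of_mem _ hy) (by simpa using hv))
    (fun y hy => by simpa using h2 (T y) (mem_image_of_mem _ hy)) x hx (by simpa using h3) w hw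
    (by simpa using h4)
  have e : T x + c • (T x - T w) = T (x + c • (x - w)) := by simp
  rw [e]
  exact ⟨mem_image_of_mem _ h5.1, by simpa using h5.2⟩

theorem exists_deepSections {n : ℕ} {q lam Lam : ℝ} (hn : 0 < n) (hq : 0 < q) (hqn : q < n)
    (hlam : 0 < lam) (hlL : lam ≤ Lam) :
    ∃ c ∈ Ioo (0 : ℝ) 1, ∀ (Ω : Set (Eucl n)) (v : Eucl n → ℝ), IsOpen Ω →
      GenSol n q lam Lam Ω v → coin Ω v = {0} → IsCompact {x ∈ Ω | v x ≤ 1} →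
      DeepSections Ω v c := by
  obtain ⟨G, hG, hvol⟩ := exists_volume_subgradImg_affSec_le hn hq hqn hlam hlL
  have hR := ellRatio_pos hn
  have hω := ballVol_pos n
  set R := ellRatio n with hRdef
  set κ : ℝ := (1 / 2) ^ (n + 1) * (1 / (64 * R)) ^ n * ballVol n with hκ
  have hκ0 : 0 < κ := by positivity
  refine ⟨min (1 / 2) (κ / (2 * G)), ⟨lt_min (by norm_num) (by positivity),
    (min_le_left _ _).trans_lt (by norm_num)⟩, fun Ω v hΩ hsol h0 hc => ?_⟩
  set c := min (1 / 2) (κ / (2 * G)) with hcdef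
  have hc0 : 0 < c := lt_min (by norm_num) (by positivity)
  have hcG : c ≤ κ / (2 * G) := min_le_right _ _
  intro a f M hM hsub hMle x hx hxM w hw hwl
  set k := (InnerProductSpace.toDual ℝ (Eucl n)).symm f with hk
  have hfk : ∀ y, f y = ⟪k, y⟫ := fun y => (InnerProductSpace.toDual_symm_apply).symm
  simp only [hfk] at hsub hMle hxM hwl ⊢
  by_contra hnot
  change x + c • (x - w) ∉ affSec Ω v a k at hnot
  have hZc : IsCompact (affSec Ω v a k) := isCompact_affSec hsol.1 hc hsub
  have hZconv : Convex ℝ (affSec Ω v a k) := convex_affSec hsol.2.1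
  obtain ⟨A, b, hA1, hA2⟩ := exists_ellipsoid hn hZc hZconv
    ⟨x, mem_interior_affSec hΩ hsol.1 hx (by linarith)⟩
  have hxZ : x ∈ affSec Ω v a k := ⟨hx, by linarith⟩
  have hwZ : w ∈ affSec Ω v a k := ⟨hw, hwl⟩
  have hup := hvol Ω v hΩ hsol h0 hc a k M hM hsub hMle A b hA1 hA2
  obtain ⟨g, s, hg1, hg2⟩ := geometric_hahn_banach_closed_point hZconv hZc.isClosed hnot
  have hgx : 0 < s - g x := sub_pos.2 (hg1 x hxZ)
  set p₀ := (s - g x)⁻¹ • (InnerProductSpace.toDual ℝ (Eucl n)).symm g with hp₀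
  have hp₀e : ∀ y, ⟪p₀, y⟫ = (s - g x)⁻¹ * g y := fun y => by
    rw [hp₀, real_inner_smul_left, InnerProductSpace.toDual_symm_apply]
  have hlow := volume_polar_ge_of_slab A (u := a + ⟪k, x⟫ - v x) (by linarith)
    (by positivity : 0 < 2 * R) hc0 (V := (fun y => y - x) '' affSec Ω v a k) (by
      rintro _ ⟨y, hy, rfl⟩
      have h1 := hA2 y hy
      have h2 := hA2 x hxZ
      have e : A.symm (y - x) = A.symm (y - b) - A.symm (x - b) := by
        rw [← map_sub]; congr 1; abel
      simp only [e]
      refine (norm_sub_le _ _).trans ?_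
      linarith) k p₀ (by
      rintro _ ⟨y, hy, rfl⟩
      simp only [hp₀e, map_sub]
      rw [inv_mul_le_iff₀ hgx]
      have := hg1 y hy
      linarith) (w := w - x) ⟨w, hwZ, rfl⟩ (by
      rw [hp₀e, neg_sub, ← mul_assoc, mul_comm c, mul_assoc, le_inv_mul_iff₀ hgx]
      simp only [map_add, map_smul, smul_eq_mul, map_sub] at hg2 ⊢
      linarith)
  have h1 := (hlow.trans (measure_mono (polar_subset_subgradImg hΩ hsol.1 hsol.2.1 hZc hx
    (by linarith) rfl))).trans hup
  have hD := absDet_pos A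
  rw [ENNReal.ofReal_le_ofReal_iff (by positivity)] at h1
  have h2 := le_of_mul_le_mul_left h1 (inv_pos.2 hD)
  have h3 : κ * (1 / c) * M ^ n ≤ G * M ^ n := by
    refine le_trans ?_ h2
    calc κ * (1 / c) * M ^ n
        = (1 / 2) ^ (n + 1) * (1 / c) * (M / 32 / (2 * R)) ^ n * ballVol n := by
          have : (M / 32 / (2 * R)) ^ n = (1 / (64 * R)) ^ n * M ^ n := by
            rw [← mul_pow]; congr 1; field_simp; norm_num
          rw [this, hκ]; ring
      _ ≤ _ := by gcongr
  have h4 := le_of_mul_le_mul_right h3 (by positivity)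
  rw [mul_one_div, div_le_iff₀ hc0] at h4
  rw [le_div_iff₀ (by positivity)] at hcG
  nlinarith

theorem absDet_symm {n : ℕ} (A : Eucl n ≃L[ℝ] Eucl n) : absDet A.symm = (absDet A)⁻¹ := by
  have h : LinearMap.det (A.symm.toLinearEquiv : Eucl n →ₗ[ℝ] Eucl n) *
      LinearMap.det (A.toLinearEquiv : Eucl n →ₗ[ℝ] Eucl n) = 1 := by
    rw [← LinearMap.det_comp]
    have : (A.symm.toLinearEquiv : Eucl n →ₗ[ℝ] Eucl n) ∘ₗ
        (A.toLinearEquiv : Eucl n →ₗ[ℝ] Eucl n) = LinearMap.id := by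
      ext1 x; simp
    rw [this, LinearMap.det_id]
  rw [absDet, absDet, eq_comm, ← abs_inv, eq_inv_of_mul_eq_one_left h]

/-- A continuous linear equivalence can be rescaled to have determinant `±1`. -/
theorem exists_absDet_one {n : ℕ} (hn : 0 < n) (A : Eucl n ≃L[ℝ] Eucl n) :
    ∃ T : Eucl n ≃L[ℝ] Eucl n, absDet T = 1 ∧
      (∀ y, T y = (absDet A ^ (n⁻¹ : ℝ)) • A.symm y) ∧
      ∀ y, T.symm y = (absDet A ^ (n⁻¹ : ℝ))⁻¹ • A y := by
  have hD := absDet_pos A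
  set s := absDet A ^ (n⁻¹ : ℝ) with hs
  have hs0 : 0 < s := Real.rpow_pos_of_pos hD _
  let T : Eucl n ≃L[ℝ] Eucl n :=
    (A.symm.toLinearEquiv.trans (LinearEquiv.smulOfNeZero ℝ (Eucl n) s
      hs0.ne')).toContinuousLinearEquiv
  have hT : ∀ y, T y = s • A.symm y := fun y => rfl
  refine ⟨T, ?_, hT, fun y => ?_⟩
  · have h : (T.toLinearEquiv : Eucl n →ₗ[ℝ] Eucl n)
        = s • (A.symm.toLinearEquiv : Eucl n →ₗ[ℝ] Eucl n) := by
      ext1 y; exact hT y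
    rw [absDet, h, LinearMap.det_smul, abs_mul, finrank_euclideanSpace_fin,
      abs_of_pos (by positivity), hs, Real.rpow_inv_natCast_pow hD.le hn.ne']
    change absDet A * absDet A.symm = 1
    rw [absDet_symm, mul_inv_cancel₀ hD.ne']
  · rw [ContinuousLinearEquiv.symm_apply_eq, hT, map_smul, A.symm_apply_apply, smul_smul,
      mul_inv_cancel₀ hs0.ne', one_smul]

theorem exists_normalization {n : ℕ} {q lam Lam : ℝ} (hn : 0 < n) (hq : 0 < q) (hqn : q < n)
    (hlam : 0 < lam) (hlL : lam ≤ Lam) {c : ℝ} (hc0 : 0 < c) :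
    ∃ r R : ℝ, 0 < r ∧ ∀ (Ω : Set (Eucl n)) (v : Eucl n → ℝ), IsOpen Ω →
      GenSol n q lam Lam Ω v → coin Ω v = {0} → IsCompact {x ∈ Ω | v x ≤ 1} →
      DeepSections Ω v c → ∃ T : Eucl n ≃L[ℝ] Eucl n, absDet T = 1 ∧
        (∀ y, ‖y‖ < r → y ∈ T '' Ω ∧ v (T.symm y) ≤ 1) ∧
        ∀ y ∈ T '' Ω, v (T.symm y) ≤ 1 → ‖y‖ < R := by
  obtain ⟨B, hB, hvol⟩ := exists_sublevel_volume_le hn hq hqn hlam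
  have hLam : 0 < Lam := hlam.trans_le hlL
  have hR := ellRatio_pos hn
  have hω := ballVol_pos n
  set R := ellRatio n with hRdef
  set ω := ballVol n with hωdef
  set δ : ℝ := (1 / (2 * R)) ^ n / (Lam * R ^ n) with hδ
  have hδ0 : 0 < δ := by positivity
  set d₁ : ℝ := min 1 δ with hd₁
  have hd₁0 : 0 < d₁ := lt_min one_pos hδ0
  set d₂ : ℝ := (B + 1) / ω with hd₂
  refine ⟨d₁ ^ (n⁻¹ : ℝ) * (c / (1 + c)), d₂ ^ (n⁻¹ : ℝ) * (2 * R) + 1, by positivity,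
    fun Ω v hΩ hsol h0 hc hdeep => ?_⟩
  have h0Ω : (0 : Eucl n) ∈ coin Ω v := by rw [h0]; rfl
  have hsub : ∀ y ∈ Ω, v y ≤ 1 + ⟪(0 : Eucl n), y⟫ → v y ≤ 1 := by
    intro y _ hy
    simpa using hy
  set Z := affSec Ω v 1 0 with hZ
  have hmem : ∀ y, y ∈ Z ↔ y ∈ Ω ∧ v y ≤ 1 := fun y => by rw [hZ, affSec_zero_right]; rfl
  have hZΩ : Z ⊆ Ω := fun y hy => hy.1
  have hZc : IsCompact Z := isCompact_affSec hsol.1 hc hsub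
  have hZconv : Convex ℝ Z := convex_affSec hsol.2.1
  have h0Z : (0 : Eucl n) ∈ Z := (hmem 0).2 ⟨h0Ω.1, by rw [h0Ω.2]; norm_num⟩
  obtain ⟨A, b, hA1, hA2⟩ := exists_ellipsoid hn hZc hZconv
    ⟨0, mem_interior_affSec hΩ hsol.1 h0Ω.1 (by rw [h0Ω.2]; simp)⟩
  have hbZ : b ∈ Z := by simpa using hA1 0 (by simp)
  have hA3 : ∀ y ∈ Z, ‖A.symm y‖ ≤ 2 * R := by
    intro y hy
    have h1 := hA2 y hy
    have h2 := hA2 0 h0Z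
    have e : A.symm y = A.symm (y - b) - A.symm (0 - b) := by
      rw [← map_sub]; congr 1; abel
    rw [e]
    refine (norm_sub_le _ _).trans ?_
    linarith
  have hD := absDet_pos A
  set D := absDet A with hDdef
  have hfin := hZc.measure_lt_top (μ := volume)
  have hD₂ : D ≤ d₂ := by
    have h2 := hvol Lam Ω v hΩ hsol h0 hc 1 ⟨one_pos, le_rfl⟩
    rw [Real.one_rpow, mul_one, ← affSec_zero_right, ← hZ] at h2
    have h3 : D * ω ≤ volume.real Z := by
      have h := volume_ellipsoid A b zero_le_one
      rw [one_pow, mul_one] at h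
      have h' : ENNReal.ofReal (D * ω) ≤ volume Z := by
        rw [← h]
        refine measure_mono ?_
        rintro _ ⟨z, hz, rfl⟩
        exact hA1 z (by simpa using hz)
      rw [Measure.real, ← ENNReal.toReal_ofReal (by positivity : 0 ≤ D * ω)]
      exact ENNReal.toReal_mono hfin.ne h'
    rw [hd₂, le_div_iff₀ hω]
    nlinarith
  have hD₁ : d₁ ≤ D := by
    have h1 := volume_polar_ge A one_pos (by positivity : 0 < 2 * R)
      (V := (fun y => y - (0 : Eucl n)) '' Z) (by
        rintro _ ⟨y, hy, rfl⟩
        simpa using hA3 y hy) 0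
    have h2 := hsol.volume_subgradImg_le hq hLam.le hZc.isClosed.measurableSet hZΩ
      zero_le_one (fun y hy => ((hmem y).1 hy).2) (volume_real_le_of_subset_ellipsoid hR.le hA2)
    have h3 := (h1.trans (measure_mono (polar_subset_subgradImg hΩ hsol.1 hsol.2.1 hZc h0Ω.1
      one_pos (by rw [h0Ω.2]; simp)))).trans h2
    rw [ENNReal.ofReal_le_ofReal_iff (by positivity), Real.one_rpow, one_mul] at h3
    have h4 : δ ≤ D ^ 2 := by
      rw [hδ, div_le_iff₀ (by positivity)]
      have h5 : 0 < D⁻¹ * ω := by positivity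
      refine le_of_mul_le_mul_right ?_ h5
      calc (1 / (2 * R)) ^ n * (D⁻¹ * ω) = D⁻¹ * (1 / (2 * R)) ^ n * ω := by ring
        _ ≤ _ := h3
        _ = _ := by rw [← hDdef, ← hωdef]; field_simp
    rcases le_or_gt 1 D with h | h
    · exact (min_le_left _ _).trans h
    · refine (min_le_right _ _).trans (h4.trans ?_)
      nlinarith
  obtain ⟨T, hT1, hT2, hT3⟩ := exists_absDet_one hn A
  set s := D ^ (n⁻¹ : ℝ) with hs
  have hs0 : 0 < s := by positivity
  have hs1 : d₁ ^ (n⁻¹ : ℝ) ≤ s := Real.rpow_le_rpow hd₁0.le hD₁ (by positivity)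
  have hs2 : s ≤ d₂ ^ (n⁻¹ : ℝ) := Real.rpow_le_rpow hD.le hD₂ (by positivity)
  refine ⟨T, hT1, fun y hy => ?_, ?_⟩
  · have hcb : -(c • b) ∈ Z := by
      have h := hdeep 1 0 1 one_pos (fun y _ hy => by simpa using hy) (fun y hy => by
        have := hsol.2.2.1 y hy
        simpa using this) 0 h0Ω.1 (by rw [h0Ω.2]; norm_num) b hbZ.1 (by
        simpa using ((hmem b).1 hbZ).2)
      rw [hmem]
      simpa using h
    have hz : ‖((1 + c) / c * s⁻¹) • y‖ ≤ 1 := by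
      rw [norm_smul, Real.norm_of_nonneg (by positivity)]
      calc (1 + c) / c * s⁻¹ * ‖y‖ ≤ (1 + c) / c * s⁻¹ * (s * (c / (1 + c))) := by
            gcongr; exact hy.le.trans (by gcongr)
        _ = 1 := by field_simp
    have h := hZconv (hA1 _ hz) hcb (a := c / (1 + c)) (b := 1 / (1 + c)) (by positivity)
      (by positivity) (by field_simp; ring)
    have e : (c / (1 + c)) • (b + A (((1 + c) / c * s⁻¹) • y)) + (1 / (1 + c)) • -(c • b)
        = T.symm y := by
      rw [hT3, map_smul, smul_add, smul_smul, smul_neg, smul_smul]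
      have e1 : 1 / (1 + c) * c = c / (1 + c) := by ring
      have e2 : c / (1 + c) * ((1 + c) / c * s⁻¹) = s⁻¹ := by field_simp
      rw [e1, e2]
      abel
    rw [e] at h
    have h' := (hmem _).1 h
    exact ⟨⟨_, h'.1, by simp⟩, h'.2⟩
  · rintro _ ⟨x, hx, rfl⟩ hv
    rw [T.symm_apply_apply] at hv
    rw [hT2, norm_smul, Real.norm_of_nonneg hs0.le]
    have h1 := hA3 x ((hmem x).2 ⟨hx, hv⟩)
    calc s * ‖A.symm x‖ ≤ d₂ ^ (n⁻¹ : ℝ) * (2 * R) := by gcongr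
      _ < _ := by linarith

section Subgradients

variable {E : Type*} [NormedAddCommGroup E] [NormedSpace ℝ E] {Ω : Set E} {v : E → ℝ}

/-- The functional `p` is a subgradient at `x` of the restriction of `v` to `Ω`. -/
def IsSubgradAt (Ω : Set E) (v : E → ℝ) (x : E) (p : E →L[ℝ] ℝ) : Prop :=
  ∀ y ∈ Ω, v x + p (y - x) ≤ v y

theorem exists_isSubgradAt (hΩ : IsOpen Ω) (hcont : ContinuousOn v Ω) (hconv : ConvexOn ℝ Ω v)
    {x : E} (hx : x ∈ Ω) : ∃ p, IsSubgradAt Ω v x p := by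
  have hopen : IsOpen {z : E × ℝ | z.1 ∈ Ω ∧ v z.1 < z.2} := by
    have h1 : ContinuousOn (fun z : E × ℝ => v z.1 - z.2) (Prod.fst ⁻¹' Ω) :=
      (hcont.comp continuousOn_fst fun z hz => hz).sub continuousOn_snd
    have h2 := h1.isOpen_inter_preimage (hΩ.preimage continuous_fst) (isOpen_Iio (a := (0 : ℝ)))
    convert h2 using 1
    ext z
    simp
  obtain ⟨f, hf⟩ := geometric_hahn_banach_open_point hconv.convex_strict_epigraph hopen
    (x := (x, v x)) (fun h => lt_irrefl _ h.2)
  set g : E →L[ℝ] ℝ := f.comp (ContinuousLinearMap.inl ℝ E ℝ) with hg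
  set β : ℝ := f (0, 1) with hβ
  have hdec : ∀ y t, f (y, t) = g y + t * β := by
    intro y t
    have e : ((y, t) : E × ℝ) = (y, 0) + t • (0, 1) := by simp
    rw [e, map_add, map_smul, smul_eq_mul]
    rfl
  have hf' : ∀ y ∈ Ω, ∀ t, v y < t → g y + t * β < g x + v x * β := by
    intro y hy t ht
    rw [← hdec, ← hdec]
    exact hf (y, t) ⟨hy, ht⟩
  have hβ0 : β < 0 := by
    have := hf' x hx (v x + 1) (by linarith)
    nlinarith
  refine ⟨(-β)⁻¹ • g, fun y hy => ?_⟩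
  have hβ1 : 0 < -β := by linarith
  rw [smul_apply, smul_eq_mul]
  by_contra! hlt
  have h1 := hf' y hy _ hlt
  have e : (v x + (-β)⁻¹ * g (y - x)) * β = v x * β - g (y - x) := by
    have : β ≠ 0 := hβ0.ne
    field_simp
    ring
  rw [e, map_sub] at h1
  linarith

end Subgradients

section NormalizedSol

variable {E : Type*} [NormedAddCommGroup E] [NormedSpace ℝ E] {Ω : Set E} {v : E → ℝ}
  {c r R : ℝ}

/-- A nonnegative convex function on an open convex set vanishing only at the origin, whose
sublevel set `{v ≤ 1}` is comparable to a ball and whose sections are uniformly deep. -/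
structure NormalizedSol (Ω : Set E) (v : E → ℝ) (c r R : ℝ) : Prop where
  isOpen : IsOpen Ω
  cont : ContinuousOn v Ω
  conv : ConvexOn ℝ Ω v
  nonneg : ∀ x ∈ Ω, 0 ≤ v x
  zero_mem : (0 : E) ∈ Ω
  map_zero : v 0 = 0
  eq_zero : ∀ x ∈ Ω, v x = 0 → x = 0
  deep : DeepSections Ω v c
  inner_ball : ∀ y, ‖y‖ < r → y ∈ Ω ∧ v y ≤ 1
  outer_ball : ∀ y ∈ Ω, v y ≤ 1 → ‖y‖ < R

/-- Points where a solution exceeds its supporting affine function by a small amount stay inside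
`{v ≤ 1}`. -/
theorem exists_le_one_of_excess_le (hc : c ∈ Ioo (0 : ℝ) 1) :
    ∃ h : ℝ, 0 < h ∧ h ≤ 1 ∧ ∀ (Ω : Set E) (v : E → ℝ), NormalizedSol Ω v c r R →
      ∀ x ∈ Ω, v x ≤ 3 / 4 → ∀ p, IsSubgradAt Ω v x p → ∀ y ∈ Ω,
      v y - v x - p (y - x) ≤ h → v y ≤ 1 := by
  obtain ⟨hc0, hc1⟩ := hc
  obtain ⟨N, hN⟩ := exists_nat_gt (26 / c)
  rw [div_lt_iff₀ hc0] at hN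
  refine ⟨1 / 32 ^ N / 32, by positivity, ?_, fun Ω v hv x hx hvx p hp y hy hg => ?_⟩
  · have : (1 : ℝ) / 32 ^ N ≤ 1 := by
      rw [div_le_one (by positivity)]; exact one_le_pow₀ (by norm_num)
    linarith
  have hε₀ : (1 : ℝ) / 32 ^ N ≤ 1 := by
    rw [div_le_one (by positivity)]; exact one_le_pow₀ (by norm_num)
  have hε₀' : (0 : ℝ) < 1 / 32 ^ N := by positivity
  by_contra! hlt
  have hx0 := hv.nonneg x hx
  have hpy : 13 / 16 - v x < p (y - x) := by linarith
  have hpy0 : 0 < p (y - x) := by linarith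
  set θ := (13 / 16 - v x) / p (y - x) with hθ
  have hθ0 : 0 < θ := div_pos (by linarith) hpy0
  have hθ1 : θ < 1 := (div_lt_one hpy0).2 hpy
  set w := x + θ • (y - x) with hw
  have hw' : w = (1 - θ) • x + θ • y := by rw [hw, smul_sub, sub_smul, one_smul]; abel
  have hwΩ : w ∈ Ω := by
    rw [hw']; exact hv.conv.1 hx hy (by linarith) hθ0.le (by ring)
  have hpw : v x + p (w - x) = 13 / 16 := by
    rw [hw, add_sub_cancel_left, map_smul, smul_eq_mul, hθ]
    field_simp
    ring
  have hgw : v w - 13 / 16 ≤ 1 / 32 ^ N / 32 := by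
    have h1 : v w ≤ (1 - θ) * v x + θ * v y := by
      rw [hw']; exact hv.conv.2 hx hy (by linarith) hθ0.le (by ring)
    have h2 : θ * p (y - x) = 13 / 16 - v x := by rw [hθ]; field_simp
    have h3 : θ * (v y - v x - p (y - x)) ≤ 1 * (1 / 32 ^ N / 32) :=
      mul_le_mul hθ1.le hg (by linarith [hp y hy]) zero_le_one
    nlinarith
  have key : ∀ k ≤ N, ∃ z ∈ Ω, v x + p (z - x) ≤ 3 / 4 - k * c / 16 ∧
      -(7 / 8) ≤ v x + p (z - x) ∧ v z - (v x + p (z - x)) ≤ 32 ^ k * (1 / 32 ^ N) / 32 := by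
    intro k hk
    induction k with
    | zero =>
      refine ⟨x, hx, by simpa using hvx, by simp; linarith, ?_⟩
      rw [sub_self, _root_.map_zero, add_zero, sub_self]
      positivity
    | succ k ih =>
      obtain ⟨z, hz, hz1, hz2, hz3⟩ := ih (by omega)
      set ε : ℝ := 32 ^ k * (1 / 32 ^ N) / 2 with hε
      have hε0 : 0 < ε := by positivity
      have hεle : ε ≤ 1 / 2 := by
        have : (32 : ℝ) ^ k ≤ 32 ^ N := pow_le_pow_right₀ (by norm_num) (by omega)
        have : (32 : ℝ) ^ k * (1 / 32 ^ N) ≤ 1 := by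
          rw [mul_one_div, div_le_one (by positivity)]; exact this
        linarith
      have hεge : 1 / 32 ^ N / 2 ≤ ε := by
        have : (1 : ℝ) ≤ 32 ^ k := one_le_pow₀ (by norm_num)
        have := mul_le_mul_of_nonneg_right this hε₀'.le
        linarith
      have hlow : ∀ y ∈ Ω, v y ≤ (1 - ε) * (v x + p (y - x)) + ε * (7 / 8) →
          -(7 / 8) ≤ v x + p (y - x) := by
        intro y hy hvy
        have h0 := hv.nonneg y hy
        by_contra! hcon
        nlinarith
      have hform : ∀ y, ((1 - ε) * (v x - p x) + ε * (7 / 8)) + ((1 - ε) • p) y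
          = (1 - ε) * (v x + p (y - x)) + ε * (7 / 8) := by
        intro y
        rw [smul_apply, smul_eq_mul, map_sub]; ring
      have hkc : 0 ≤ k * c / 16 := by positivity
      have h := hv.deep ((1 - ε) * (v x - p x) + ε * (7 / 8)) ((1 - ε) • p) (2 * ε) (by positivity)
        (fun y hy hvy => by
          rw [hform] at hvy
          have := hp y hy
          nlinarith)
        (fun y hy => by
          rw [hform]
          rcases le_or_gt (v y) ((1 - ε) * (v x + p (y - x)) + ε * (7 / 8)) with h1 | h1
          · have h2 := hlow y hy h1
            have h3 := hp y hy
            nlinarith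
          · linarith) z hz (by rw [hform]; nlinarith) w hwΩ (by
          rw [hform, hpw]; nlinarith)
      obtain ⟨hz'Ω, hz'⟩ := h
      rw [hform] at hz'
      have hl := hlow _ hz'Ω hz'
      have hpz' : v x + p (z + c • (z - w) - x)
          = v x + p (z - x) + c * (v x + p (z - x) - (v x + p (w - x))) := by
        simp only [map_sub, map_add, map_smul, smul_eq_mul]; ring
      refine ⟨_, hz'Ω, ?_, hl, ?_⟩
      · rw [hpz', hpw]
        push_cast
        nlinarith
      · have : (32 : ℝ) ^ (k + 1) * (1 / 32 ^ N) / 32 = 2 * ε := by rw [hε, pow_succ]; ring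
        rw [this]
        nlinarith
  obtain ⟨z, _, h1, h2, _⟩ := key N le_rfl
  linarith

end NormalizedSol

section NormalizedSol

variable {E : Type*} [NormedAddCommGroup E] [NormedSpace ℝ E] {Ω : Set E} {v : E → ℝ}
  {c r R : ℝ}

/-- The gap in one direction of a pair of supporting functionals is controlled by the gap in the
opposite direction. -/
theorem NormalizedSol.gap_le (hv : NormalizedSol Ω v c r R) {h : ℝ} (hh : 0 < h)
    (hle : ∀ x ∈ Ω, v x ≤ 3 / 4 → ∀ p, IsSubgradAt Ω v x p → ∀ y ∈ Ω,
      v y - v x - p (y - x) ≤ h → v y ≤ 1) {x y : E} (hx : x ∈ Ω) (hy : y ∈ Ω) (hvy : v y ≤ 3 / 4)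
    {p p' : E →L[ℝ] ℝ} (hp : IsSubgradAt Ω v x p) (hp' : IsSubgradAt Ω v y p')
    (hsmall : v x - v y - p' (x - y) < h / 2) :
    c * (p' - p) (y - x) ≤ v x - v y - p' (x - y) := by
  have hg0 : 0 ≤ v x - v y - p' (x - y) := by linarith [hp' x hx]
  have key : ∀ s, v x - v y - p' (x - y) ≤ s → 0 < s → s ≤ h / 2 →
      c * (p' - p) (y - x) ≤ 2 * s - (v x - v y - p' (x - y)) := by
    intro s hs1 hs0 hs2
    have e : ∀ z, (v y - p' y + 2 * s) + p' z = v y + p' (z - y) + 2 * s := fun z => by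
      rw [map_sub]; ring
    have hd := hv.deep (v y - p' y + 2 * s) p' (2 * s) (by positivity)
      (fun z hz hvz => hle y hy hvy p' hp' z hz (by rw [e] at hvz; linarith))
      (fun z hz => by rw [e]; linarith [hp' z hz]) x hx (by rw [e]; linarith) y hy (by
        rw [e]; simp only [sub_self, _root_.map_zero]; linarith)
    rw [e] at hd
    have h1 := hp _ hd.1
    have h2 := hd.2
    simp only [map_sub, map_add, map_smul, smul_eq_mul, sub_apply] at *
    linarith
  rcases hg0.eq_or_lt with h0 | h0
  · rw [← h0]
    refine le_of_forall_pos_le_add fun ε hε => ?_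
    have h1 := key (min (ε / 2) (h / 2)) (by rw [← h0]; positivity) (by positivity)
      (min_le_right _ _)
    have := min_le_left (ε / 2) (h / 2)
    linarith
  · linarith [key _ le_rfl h0 hsmall.le]

theorem NormalizedSol.ball_subset (hv : NormalizedSol Ω v c r R) (hc : 0 < c) (hr : 0 < r) {x : E}
    (hx : x ∈ Ω) (hvx : v x ≤ 3 / 4) {z : E} (hz : ‖z - x‖ < c / (1 + c) * r) :
    z ∈ Ω ∧ v z ≤ 1 := by
  have h1 := hv.deep 1 0 1 one_pos (fun y _ hy => by simpa using hy) (fun y hy => by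
    simpa using hv.nonneg y hy) x hx (by simp; linarith) 0 hv.zero_mem (by simp [hv.map_zero])
  simp only [sub_zero, zero_apply, add_zero] at h1
  have h2 := hv.inner_ball (((1 + c) / c) • (z - x)) (by
    rw [norm_smul, Real.norm_of_nonneg (by positivity)]
    calc (1 + c) / c * ‖z - x‖ < (1 + c) / c * (c / (1 + c) * r) := by gcongr
      _ = r := by field_simp)
  have e : z = (1 / (1 + c)) • (x + c • x) + (c / (1 + c)) • (((1 + c) / c) • (z - x)) := by
    rw [smul_smul, smul_add, smul_smul]
    have e1 : c / (1 + c) * ((1 + c) / c) = 1 := by field_simp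
    rw [e1, one_smul, ← add_smul]
    have e2 : 1 / (1 + c) + 1 / (1 + c) * c = 1 := by field_simp
    rw [e2, one_smul]; abel
  have ha : 0 ≤ 1 / (1 + c) := by positivity
  have hb : 0 ≤ c / (1 + c) := by positivity
  have hab : 1 / (1 + c) + c / (1 + c) = 1 := by field_simp
  refine ⟨?_, ?_⟩
  · rw [e]; exact hv.conv.1 h1.1 h2.1 ha hb hab
  · have h3 := hv.conv.2 h1.1 h2.1 ha hb hab
    rw [← e, smul_eq_mul, smul_eq_mul] at h3
    have h4 := mul_le_mul_of_nonneg_left h1.2 ha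
    have h5 := mul_le_mul_of_nonneg_left h2.2 hb
    linarith

theorem NormalizedSol.le_three_quarters (hv : NormalizedSol Ω v c r R) (hc : 0 < c) (hr : 0 < r)
    {x : E} (hx : x ∈ Ω) (hvx : v x ≤ 1 / 2) {z : E} (hz : ‖z - x‖ ≤ c / (1 + c) * r / 8) :
    z ∈ Ω ∧ v z ≤ 3 / 4 := by
  have hpos : 0 < c / (1 + c) * r := by positivity
  have h1 := hv.ball_subset hc hr hx (by linarith) (z := x + (4 : ℝ) • (z - x)) (by
    rw [add_sub_cancel_left, norm_smul, Real.norm_of_nonneg (by norm_num)]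
    linarith)
  have e : z = (3 / 4 : ℝ) • x + (1 / 4 : ℝ) • (x + (4 : ℝ) • (z - x)) := by module
  refine ⟨by rw [e]; exact hv.conv.1 hx h1.1 (by norm_num) (by norm_num) (by norm_num), ?_⟩
  have h2 := hv.conv.2 hx h1.1 (by norm_num : (0 : ℝ) ≤ 3 / 4) (by norm_num : (0 : ℝ) ≤ 1 / 4)
    (by norm_num)
  rw [← e, smul_eq_mul, smul_eq_mul] at h2
  linarith [h1.2]

theorem norm_le_of_forall_le {p : E →L[ℝ] ℝ} {s K : ℝ} (hs : 0 < s) (hK : 0 ≤ K)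
    (h : ∀ u, ‖u‖ ≤ s → p u ≤ K) : ‖p‖ ≤ K / s := by
  have h1 : ∀ u, p u ≤ K / s * ‖u‖ := by
    intro u
    rcases eq_or_ne u 0 with rfl | hu
    · simp
    have hu' : 0 < ‖u‖ := norm_pos_iff.2 hu
    have h2 := h ((s / ‖u‖) • u) (by
      rw [norm_smul, Real.norm_of_nonneg (by positivity), div_mul_cancel₀ _ hu'.ne'])
    rw [map_smul, smul_eq_mul, div_mul_eq_mul_div, div_le_iff₀ hu'] at h2
    rw [div_mul_eq_mul_div, le_div_iff₀ hs]
    linarith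
  refine p.opNorm_le_bound (by positivity) fun u => ?_
  rw [Real.norm_eq_abs]
  refine abs_le.2 ⟨?_, h1 u⟩
  have := h1 (-u)
  rw [map_neg, norm_neg] at this
  linarith

theorem NormalizedSol.norm_subgrad_le (hv : NormalizedSol Ω v c r R) (hc : 0 < c) (hr : 0 < r)
    {x : E} (hx : x ∈ Ω) (hvx : v x ≤ 3 / 4) {p : E →L[ℝ] ℝ} (hp : IsSubgradAt Ω v x p) :
    ‖p‖ ≤ 2 / (c / (1 + c) * r) := by
  have hpos : 0 < c / (1 + c) * r := by positivity
  have h := norm_le_of_forall_le (p := p) (half_pos hpos) zero_le_one fun u hu => by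
    have h1 := hv.ball_subset hc hr hx hvx (z := x + u) (by rw [add_sub_cancel_left]; linarith)
    have h2 := hp _ h1.1
    rw [add_sub_cancel_left] at h2
    linarith [hv.nonneg x hx, h1.2]
  refine h.trans (le_of_eq ?_)
  field_simp

/-- Superlinear growth away from the supporting hyperplanes. -/
theorem exists_excess_le_rpow (hc : c ∈ Ioo (0 : ℝ) 1) (hr : 0 < r) :
    ∃ α ρ C : ℝ, 0 < α ∧ 0 < ρ ∧ ρ ≤ 1 ∧ 0 < C ∧ ∀ (Ω : Set E) (v : E → ℝ),
      NormalizedSol Ω v c r R → ∀ x ∈ Ω, v x ≤ 1 / 2 → ∀ p, IsSubgradAt Ω v x p →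
      ∀ z, ‖z - x‖ ≤ ρ → z ∈ Ω ∧ v z ≤ 3 / 4 ∧ v z - v x - p (z - x) ≤ C * ‖z - x‖ ^ (1 + α) := by
  obtain ⟨h, hh, hh1, hle⟩ := exists_le_one_of_excess_le (E := E) (r := r) (R := R) hc
  obtain ⟨hc0, hc1⟩ := hc
  set r' := c / (1 + c) * r with hr'
  have hr'0 : 0 < r' := by positivity
  set c' := min c (h / 2 / (5 / 4 + h / 2)) with hc'
  have hc'0 : 0 < c' := lt_min hc0 (by positivity)
  have hc'1 : c' < 1 := (min_le_left _ _).trans_lt hc1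
  have hc'c : c' ≤ c := min_le_left _ _
  have hc'h : c' * (5 / 4 + h / 2) ≤ h / 2 := (le_div_iff₀ (by positivity)).1 (min_le_right _ _)
  set θ := (1 - c') / (2 - c') with hθ
  have hθ0 : 0 < θ := div_pos (by linarith) (by linarith)
  have hθ2 : θ < 1 / 2 := by rw [hθ, div_lt_iff₀ (by linarith)]; linarith
  set α := Real.logb (1 / 2) θ - 1 with hα
  have hα0 : 0 < α := by
    rw [hα, sub_pos, Real.lt_logb_iff_rpow_lt_of_base_lt_one (by norm_num) (by norm_num) hθ0]
    simpa using hθ2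
  have hθα : (1 / 2 : ℝ) ^ (1 + α) = θ := by
    rw [hα, add_sub_cancel, Real.rpow_logb (by norm_num) (by norm_num) hθ0]
  set ρ := min (r' / 8) 1 with hρ
  have hρ0 : 0 < ρ := lt_min (by positivity) one_pos
  refine ⟨α, ρ, 5 / 4 * (2 / ρ) ^ (1 + α), hα0, hρ0, min_le_right _ _, by positivity,
    fun Ω v hv x hx hvx p hp => ?_⟩
  have hin : ∀ z, ‖z - x‖ ≤ ρ → z ∈ Ω ∧ v z ≤ 3 / 4 := fun z hz =>
    hv.le_three_quarters hc0 hr hx hvx (hz.trans (min_le_left _ _))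
  have hx0 := hv.nonneg x hx
  have hbdd : ∀ z, ‖z - x‖ ≤ ρ → v z - v x - p (z - x) ≤ 5 / 4 := by
    intro z hz
    have h1 := hv.norm_subgrad_le hc0 hr hx (by linarith) hp
    have h2 : -(p (z - x)) ≤ 2 / r' * (r' / 8) := by
      refine (neg_le_abs _).trans ((p.le_opNorm _).trans ?_)
      exact mul_le_mul h1 (hz.trans (min_le_left _ _)) (norm_nonneg _) (by positivity)
    have h3 : 2 / r' * (r' / 8) = 1 / 4 := by field_simp; norm_num
    linarith [(hin z hz).2]
  have hhalf : ∀ u, ‖u‖ ≤ ρ → v (x + (1 / 2 : ℝ) • u) - v x - p ((1 / 2 : ℝ) • u) ≤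
      θ * (v (x + u) - v x - p u) := by
    intro u hu
    set y := x + (1 / 2 : ℝ) • u with hy
    have hyx : y - x = (1 / 2 : ℝ) • u := by rw [hy, add_sub_cancel_left]
    have hyn : ‖y - x‖ ≤ ρ := by
      rw [hyx, norm_smul, Real.norm_of_nonneg (by norm_num)]
      linarith [norm_nonneg u]
    have hz := hin (x + u) (by rwa [add_sub_cancel_left])
    obtain ⟨hyΩ, hvy⟩ := hin y hyn
    obtain ⟨p', hp'⟩ := exists_isSubgradAt hv.isOpen hv.cont hv.conv hyΩ
    have h1 := hp' x hx
    have h2 := hp' _ hz.1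
    have h3 := hp y hyΩ
    have h4 := hbdd y hyn
    have e1 : x + u - y = (1 / 2 : ℝ) • u := by rw [hy]; module
    have e2 : x - y = -((1 / 2 : ℝ) • u) := by rw [hy]; module
    have h5 : c' * (p' - p) (y - x) ≤ v x - v y - p' (x - y) := by
      have e3 : (p' - p) (y - x) = (v y - v x - p (y - x)) + (v x - v y - p' (x - y)) := by
        rw [e2, hyx]; simp only [sub_apply, map_neg]; ring
      rcases lt_or_ge (v x - v y - p' (x - y)) (h / 2) with hs | hs
      · refine le_trans ?_ (hv.gap_le hh (hle Ω v hv) hx hyΩ hvy hp hp' hs)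
        refine mul_le_mul_of_nonneg_right hc'c ?_
        rw [e3]; linarith
      · rw [e3]
        have : c' * (v y - v x - p (y - x)) ≤ c' * (5 / 4) := by gcongr
        nlinarith
    rw [e1] at h2
    rw [e2] at h1 h5
    rw [hyx] at h3 h5
    simp only [sub_apply, map_neg, map_smul, smul_eq_mul] at h1 h2 h3 h5 ⊢
    have h6 := mul_le_mul_of_nonneg_left (by linarith : (v y - v x - 1 / 2 * p u) +
      1 / 2 * (p' u - p u) ≤ v (x + u) - v x - p u) (by linarith : 0 ≤ 1 - c')
    rw [hθ, div_mul_eq_mul_div (1 - c'), le_div_iff₀ (by linarith)]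
    linarith
  have hiter : ∀ (k : ℕ) u, ‖u‖ ≤ ρ →
      v (x + (1 / 2 : ℝ) ^ k • u) - v x - p ((1 / 2 : ℝ) ^ k • u) ≤ θ ^ k * (5 / 4) := by
    intro k u hu
    induction k with
    | zero =>
      have := hbdd (x + u) (by rwa [add_sub_cancel_left])
      rw [add_sub_cancel_left] at this
      simpa using this
    | succ k ih =>
      have h1 := hhalf ((1 / 2 : ℝ) ^ k • u) (by
        rw [norm_smul, Real.norm_of_nonneg (by positivity)]
        have : (1 / 2 : ℝ) ^ k ≤ 1 := pow_le_one₀ (by norm_num) (by norm_num)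
        nlinarith [norm_nonneg u])
      rw [smul_smul, ← pow_succ'] at h1
      rw [pow_succ' θ, mul_assoc]
      exact h1.trans (by gcongr)
  intro z hz
  refine ⟨(hin z hz).1, (hin z hz).2, ?_⟩
  rcases eq_or_ne z x with rfl | hne
  · simp only [sub_self, _root_.map_zero, norm_zero]
    positivity
  have hzx : 0 < ‖z - x‖ := norm_pos_iff.2 (sub_ne_zero.2 hne)
  obtain ⟨k, hk1, hk2⟩ := exists_nat_pow_near_of_lt_one (x := ‖z - x‖ / ρ) (y := 1 / 2)
    (by positivity) ((div_le_one hρ0).2 hz) (by norm_num) (by norm_num)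
  have hk3 := hiter k ((2 : ℝ) ^ k • (z - x)) (by
    rw [norm_smul, Real.norm_of_nonneg (by positivity)]
    rw [div_le_iff₀ hρ0] at hk2
    calc (2 : ℝ) ^ k * ‖z - x‖ ≤ 2 ^ k * ((1 / 2) ^ k * ρ) := by gcongr
      _ = ρ := by rw [← mul_assoc, ← mul_pow]; norm_num)
  rw [smul_smul, ← mul_pow] at hk3
  rw [one_div, inv_mul_cancel₀ two_ne_zero, one_pow, one_smul, add_sub_cancel] at hk3
  refine hk3.trans ?_
  have h1 : θ ^ k ≤ (2 / ρ) ^ (1 + α) * ‖z - x‖ ^ (1 + α) := by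
    rw [← hθα, ← Real.rpow_natCast, ← Real.rpow_mul (by norm_num), mul_comm (1 + α),
      Real.rpow_mul (by norm_num), Real.rpow_natCast, ← Real.mul_rpow (by positivity) hzx.le]
    refine Real.rpow_le_rpow (by positivity) ?_ (by linarith)
    rw [pow_succ] at hk1
    have : 2 / ρ * ‖z - x‖ = 2 * (‖z - x‖ / ρ) := by ring
    rw [this]
    linarith
  linarith

/-- Polynomial lower growth at the origin. -/
theorem NormalizedSol.le_growth (hv : NormalizedSol Ω v c r R) (hc : c ∈ Ioo (0 : ℝ) 1) {y : E}
    (hy : y ∈ Ω) (hvy : v y ≤ 1 / 2) :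
    ‖y‖ ^ (Real.logb (1 + c) 2) ≤ R ^ (Real.logb (1 + c) 2) * 4 * v y := by
  obtain ⟨hc0, hc1⟩ := hc
  set m := Real.logb (1 + c) 2 with hm
  have hm0 : 0 < m := Real.logb_pos (by linarith) one_lt_two
  have hR : 0 < R := by
    simpa using hv.outer_ball 0 hv.zero_mem (by rw [hv.map_zero]; norm_num)
  rcases eq_or_ne y 0 with rfl | hne
  · rw [norm_zero, Real.zero_rpow hm0.ne', hv.map_zero, mul_zero]
  have hv0 : 0 < v y := lt_of_le_of_ne (hv.nonneg y hy) fun h => hne (hv.eq_zero y hy h.symm)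
  obtain ⟨k, hk1, hk2⟩ := exists_nat_pow_near_of_lt_one (x := 2 * v y) (y := 1 / 2)
    (by positivity) (by linarith) (by norm_num) (by norm_num)
  have hiter : ∀ j ≤ k, (1 + c) ^ j • y ∈ Ω ∧ v ((1 + c) ^ j • y) ≤ 2 ^ j * v y := by
    intro j hj
    induction j with
    | zero => simpa using hy
    | succ j ih =>
      obtain ⟨h1, h2⟩ := ih (by omega)
      have h3 : (2 : ℝ) ^ (j + 1) * v y ≤ 1 := by
        have h4 : (2 : ℝ) ^ (j + 1) ≤ 2 ^ k := pow_le_pow_right₀ one_le_two hj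
        have h5 : (2 : ℝ) ^ k * (1 / 2) ^ k = 1 := by rw [← mul_pow]; norm_num
        have h6 : (2 : ℝ) ^ k * (2 * v y) ≤ 2 ^ k * (1 / 2) ^ k := by gcongr
        have h7 : (2 : ℝ) ^ (j + 1) * v y ≤ 2 ^ k * v y := by gcongr
        nlinarith
      have hpos : 0 < (2 : ℝ) ^ (j + 1) * v y := by positivity
      have hd := hv.deep (2 ^ (j + 1) * v y) 0 (2 ^ (j + 1) * v y) hpos
        (fun z _ hz => by simp only [zero_apply, add_zero] at hz; linarith)
        (fun z hz => by simpa using hv.nonneg z hz) _ h1 (by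
          simp only [zero_apply, add_zero]; rw [pow_succ] at hpos ⊢; linarith) 0 hv.zero_mem
        (by simp only [zero_apply, add_zero, hv.map_zero]; exact hpos.le)
      simp only [zero_apply, add_zero, sub_zero] at hd
      have e : (1 + c) ^ j • y + c • (1 + c) ^ j • y = (1 + c) ^ (j + 1) • y := by
        rw [smul_smul, ← add_smul, pow_succ]; ring_nf
      rwa [e] at hd
  obtain ⟨h1, h2⟩ := hiter k le_rfl
  have h3 : (2 : ℝ) ^ k * v y ≤ 1 := by
    have h5 : (2 : ℝ) ^ k * (1 / 2) ^ k = 1 := by rw [← mul_pow]; norm_num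
    have h6 : (2 : ℝ) ^ k * (2 * v y) ≤ 2 ^ k * (1 / 2) ^ k := by gcongr
    linarith [mul_pos (pow_pos two_pos k : (0 : ℝ) < 2 ^ k) hv0]
  have h4 := (hv.outer_ball _ h1 (h2.trans h3)).le
  rw [norm_smul, Real.norm_of_nonneg (by positivity)] at h4
  have h5 := Real.rpow_le_rpow (by positivity) h4 hm0.le
  rw [Real.mul_rpow (by positivity) (norm_nonneg _), ← Real.rpow_natCast, ← Real.rpow_mul
    (by positivity), mul_comm (k : ℝ), Real.rpow_mul (by positivity), Real.rpow_logb (by linarith)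
    (by linarith) two_pos, Real.rpow_natCast] at h5
  have h6 : 1 ≤ 2 ^ k * (4 * v y) := by
    have h7 : (2 : ℝ) ^ (k + 1) * (1 / 2) ^ (k + 1) = 1 := by rw [← mul_pow]; norm_num
    have h8 : (2 : ℝ) ^ (k + 1) * (1 / 2) ^ (k + 1) ≤ 2 ^ (k + 1) * (2 * v y) := by gcongr
    rw [h7, pow_succ] at h8
    linarith
  have hRm : 0 < R ^ m := by positivity
  calc ‖y‖ ^ m = 1 * ‖y‖ ^ m := (one_mul _).symm
    _ ≤ 2 ^ k * (4 * v y) * ‖y‖ ^ m := by gcongr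
    _ = (2 ^ k * ‖y‖ ^ m) * (4 * v y) := by ring
    _ ≤ R ^ m * (4 * v y) := by gcongr
    _ = _ := by ring

end NormalizedSol

section NormalizedSol

variable {E : Type*} [NormedAddCommGroup E] [NormedSpace ℝ E] {Ω : Set E} {v : E → ℝ}
  {c r R : ℝ}

theorem hasFDerivAt_of_excess_le {x : E} {p : E →L[ℝ] ℝ} {α ρ C : ℝ} (hα : 0 < α) (hρ : 0 < ρ)
    (h : ∀ z, ‖z - x‖ ≤ ρ → |v z - v x - p (z - x)| ≤ C * ‖z - x‖ ^ (1 + α)) :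
    HasFDerivAt v p x := by
  rw [hasFDerivAt_iff_isLittleO, Asymptotics.isLittleO_iff]
  intro ε hε
  have hlim : Filter.Tendsto (fun z => C * ‖z - x‖ ^ α) (nhds x) (nhds 0) := by
    have h1 : Continuous fun z => C * ‖z - x‖ ^ α :=
      continuous_const.mul ((continuous_id.sub continuous_const).norm.rpow_const
        fun _ => Or.inr hα.le)
    have h2 := h1.tendsto x
    simpa [hα.ne'] using h2
  filter_upwards [hlim.eventually_lt_const hε, closedBall_mem_nhds x hρ] with z hz1 hz2
  rw [mem_closedBall, dist_eq_norm] at hz2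
  rw [Real.norm_eq_abs]
  refine (h z hz2).trans ?_
  rcases (norm_nonneg (z - x)).eq_or_lt with h0 | h0
  · rw [← h0, Real.zero_rpow (by linarith)]; simp
  rw [Real.rpow_add h0, Real.rpow_one]
  calc C * (‖z - x‖ * ‖z - x‖ ^ α) = (C * ‖z - x‖ ^ α) * ‖z - x‖ := by ring
    _ ≤ ε * ‖z - x‖ := by gcongr

theorem norm_sub_le_of_excess_le {x y : E} {p p' : E →L[ℝ] ℝ} {s K : ℝ} (hs : 0 < s) (hK : 0 ≤ K)
    (hxy : ‖y - x‖ ≤ s) (hp : IsSubgradAt Ω v x p) (hp' : IsSubgradAt Ω v y p') (hy : y ∈ Ω)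
    (h : ∀ z, ‖z - x‖ ≤ 2 * s → z ∈ Ω ∧ v z - v x - p (z - x) ≤ K) : ‖p' - p‖ ≤ K / s := by
  refine norm_le_of_forall_le hs hK fun u hu => ?_
  obtain ⟨h1, h2⟩ := h (y + u) (by
    have : y + u - x = (y - x) + u := by abel
    rw [this]
    exact (norm_add_le _ _).trans (by linarith))
  have h3 := hp' _ h1
  have h4 := hp _ hy
  simp only [map_sub, map_add, sub_apply] at *
  linarith

/-- Uniform `C^{1,α}` estimates and growth rates for normalized solutions. -/
theorem exists_regularity (hc : c ∈ Ioo (0 : ℝ) 1) (hr : 0 < r) (R : ℝ) :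
    ∃ α c' C : ℝ, α ∈ Ioo (0 : ℝ) 1 ∧ 0 < c' ∧ c' < C ∧ c' ≤ r ∧ R ≤ C ∧
      ∀ (Ω : Set E) (v : E → ℝ), NormalizedSol Ω v c r R →
        (∀ y ∈ Ω, v y ≤ 1 / 2 → DifferentiableAt ℝ v y ∧ |v y| + ‖fderiv ℝ v y‖ ≤ C) ∧
        (∀ y ∈ Ω, ∀ z ∈ Ω, v y ≤ 1 / 2 → v z ≤ 1 / 2 →
          ‖fderiv ℝ v y - fderiv ℝ v z‖ ≤ C * ‖y - z‖ ^ α) ∧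
        ∀ y, ‖y‖ < c' → c' * ‖y‖ ^ ((1 + α) / α) ≤ v y ∧ v y ≤ C * ‖y‖ ^ (1 + α) := by
  obtain ⟨α₀, ρ, K, hα₀, hρ, hρ1, hK, hgrow⟩ := exists_excess_le_rpow (E := E) (R := R) hc hr
  obtain ⟨hc0, hc1⟩ := id hc
  set m := Real.logb (1 + c) 2 with hm
  have hm0 : 0 < m := Real.logb_pos (by linarith) one_lt_two
  set α := min (min α₀ (1 / m)) (1 / 2) with hα
  have hα0 : 0 < α := lt_min (lt_min hα₀ (by positivity)) (by norm_num)
  have hα1 : α < 1 := (min_le_right _ _).trans_lt (by norm_num)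
  have hαα₀ : α ≤ α₀ := (min_le_left _ _).trans (min_le_left _ _)
  have hαm : m ≤ (1 + α) / α := by
    have h1 : α ≤ 1 / m := (min_le_left _ _).trans (min_le_right _ _)
    rw [le_div_iff₀ hm0] at h1
    rw [le_div_iff₀ hα0]
    linarith
  set G := 2 / (c / (1 + c) * r) with hG
  have hG0 : 0 < G := by positivity
  set S := (max R 1) ^ m * 4 with hS
  have hS0 : 0 < S := by positivity
  set c' := min (min (r / 2) ρ) (1 / S) with hc'
  have hc'0 : 0 < c' := lt_min (lt_min (by positivity) hρ) (by positivity)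
  have hc'r : c' ≤ r / 2 := (min_le_left _ _).trans (min_le_left _ _)
  have hc'ρ : c' ≤ ρ := (min_le_left _ _).trans (min_le_right _ _)
  have hc'S : c' ≤ 1 / S := min_le_right _ _
  set C := 2 + |R| + G + 4 * K + 2 * G * (2 / ρ) with hC
  have hGρ : 0 ≤ 2 * G * (2 / ρ) := by positivity
  have hR0 := abs_nonneg R
  refine ⟨α, c', C, ⟨hα0, hα1⟩, hc'0, by linarith, by linarith, by linarith [le_abs_self R],
    fun Ω v hv => ?_⟩
  have hgrow' : ∀ x ∈ Ω, v x ≤ 1 / 2 → ∀ p, IsSubgradAt Ω v x p → ∀ z, ‖z - x‖ ≤ ρ →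
      z ∈ Ω ∧ v z - v x - p (z - x) ≤ K * ‖z - x‖ ^ (1 + α) := by
    intro x hx hvx p hp z hz
    obtain ⟨h1, _, h2⟩ := hgrow Ω v hv x hx hvx p hp z hz
    refine ⟨h1, h2.trans ?_⟩
    refine mul_le_mul_of_nonneg_left ?_ hK.le
    exact Real.rpow_le_rpow_of_exponent_ge' (norm_nonneg _) (hz.trans hρ1) (by linarith)
      (by linarith)
  have hderiv : ∀ x ∈ Ω, v x ≤ 1 / 2 → ∃ p, IsSubgradAt Ω v x p ∧ HasFDerivAt v p x := by
    intro x hx hvx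
    obtain ⟨p, hp⟩ := exists_isSubgradAt hv.isOpen hv.cont hv.conv hx
    refine ⟨p, hp, hasFDerivAt_of_excess_le (C := K) hα0 hρ fun z hz => ?_⟩
    obtain ⟨h1, h2⟩ := hgrow' x hx hvx p hp z hz
    rwa [abs_of_nonneg (by linarith [hp z h1])]
  have hlip : ∀ x ∈ Ω, v x ≤ 1 / 2 → ∀ p, IsSubgradAt Ω v x p → ‖p‖ ≤ G := fun x hx hvx p hp =>
    hv.norm_subgrad_le hc0 hr hx (by linarith) hp
  refine ⟨fun y hy hvy => ?_, fun y hy z hz hvy hvz => ?_, fun y hy => ?_⟩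
  · obtain ⟨p, hp, hd⟩ := hderiv y hy hvy
    refine ⟨hd.differentiableAt, ?_⟩
    rw [hd.fderiv, abs_of_nonneg (hv.nonneg y hy)]
    linarith [hlip y hy hvy p hp]
  · obtain ⟨p', hp', hd'⟩ := hderiv y hy hvy
    obtain ⟨p, hp, hd⟩ := hderiv z hz hvz
    rw [hd.fderiv, hd'.fderiv]
    rcases (norm_nonneg (y - z)).eq_or_lt with h0 | h0
    · have hyz : y = z := sub_eq_zero.1 (norm_eq_zero.1 h0.symm)
      subst hyz
      rw [hd.unique hd', sub_self, norm_zero]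
      positivity
    rcases le_or_gt (2 * ‖y - z‖) ρ with hs | hs
    · have h1 := norm_sub_le_of_excess_le h0 (K := K * (2 * ‖y - z‖) ^ (1 + α)) (by positivity)
        le_rfl hp hp' hy fun w hw => by
          obtain ⟨h2, h3⟩ := hgrow' z hz hvz p hp w (hw.trans hs)
          exact ⟨h2, h3.trans (by gcongr)⟩
      refine h1.trans ?_
      rw [div_le_iff₀ h0, Real.mul_rpow (by norm_num) h0.le, Real.rpow_add h0, Real.rpow_one]
      have h4 : (2 : ℝ) ^ (1 + α) ≤ 4 := by
        calc (2 : ℝ) ^ (1 + α) ≤ 2 ^ (2 : ℝ) :=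
              Real.rpow_le_rpow_of_exponent_le (by norm_num) (by linarith)
          _ = 4 := by norm_num
      have hpos : 0 < ‖y - z‖ ^ α := by positivity
      calc K * (2 ^ (1 + α) * (‖y - z‖ * ‖y - z‖ ^ α))
          ≤ K * (4 * (‖y - z‖ * ‖y - z‖ ^ α)) := by gcongr
        _ = (4 * K) * ‖y - z‖ ^ α * ‖y - z‖ := by ring
        _ ≤ _ := by gcongr; linarith
    · have h1 : ‖p' - p‖ ≤ 2 * G := by
        refine (norm_sub_le _ _).trans ?_
        linarith [hlip y hy hvy p' hp', hlip z hz hvz p hp]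
      have h2 : 1 ≤ (2 / ρ) * ‖y - z‖ ^ α := by
        have h3 : (ρ / 2) ^ α ≤ ‖y - z‖ ^ α :=
          Real.rpow_le_rpow (by positivity) (by linarith) hα0.le
        have h4 : ρ / 2 ≤ (ρ / 2) ^ α := by
          have := Real.rpow_le_rpow_of_exponent_ge (x := ρ / 2) (by positivity) (by linarith) hα1.le
          rwa [Real.rpow_one] at this
        calc 1 = (2 / ρ) * (ρ / 2) := by field_simp
          _ ≤ _ := by gcongr; exact h4.trans h3
      calc ‖p' - p‖ ≤ 2 * G * 1 := by linarith
        _ ≤ 2 * G * ((2 / ρ) * ‖y - z‖ ^ α) := by gcongr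
        _ = 2 * G * (2 / ρ) * ‖y - z‖ ^ α := by ring
        _ ≤ _ := by gcongr; linarith
  · have hy1 := hv.inner_ball ((2 : ℝ) • y) (by
      rw [norm_smul, Real.norm_of_nonneg (by norm_num)]; linarith)
    have e : y = (1 / 2 : ℝ) • (0 : E) + (1 / 2 : ℝ) • ((2 : ℝ) • y) := by module
    have hyΩ : y ∈ Ω := by
      rw [e]; exact hv.conv.1 hv.zero_mem hy1.1 (by norm_num) (by norm_num) (by norm_num)
    have hvy : v y ≤ 1 / 2 := by
      have h := hv.conv.2 hv.zero_mem hy1.1 (by norm_num : (0 : ℝ) ≤ 1 / 2)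
        (by norm_num : (0 : ℝ) ≤ 1 / 2) (by norm_num)
      rw [← e, hv.map_zero, smul_eq_mul, smul_eq_mul] at h
      linarith [hy1.2]
    constructor
    · have h1 := hv.le_growth hc hyΩ hvy
      have h2 : R ^ m * 4 ≤ S := by
        have hR : 0 < R := by
          simpa using hv.outer_ball 0 hv.zero_mem (by rw [hv.map_zero]; norm_num)
        have : R ^ m ≤ (max R 1) ^ m := Real.rpow_le_rpow hR.le (le_max_left _ _) hm0.le
        linarith
      have h3 : ‖y‖ ^ ((1 + α) / α) ≤ ‖y‖ ^ m :=
        Real.rpow_le_rpow_of_exponent_ge' (norm_nonneg _) (by linarith) hm0.le hαm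
      calc c' * ‖y‖ ^ ((1 + α) / α) ≤ 1 / S * (S * v y) := by
            have := mul_le_mul_of_nonneg_right h2 (hv.nonneg y hyΩ)
            gcongr
            linarith
        _ = v y := by field_simp
    · have h1 := (hgrow' 0 hv.zero_mem (by rw [hv.map_zero]; norm_num) 0 (fun z hz => by
        simpa [hv.map_zero] using hv.nonneg z hz) y (by rw [sub_zero]; linarith)).2
      simp only [hv.map_zero, zero_apply, sub_zero] at h1
      refine h1.trans ?_
      gcongr
      linarith

end NormalizedSol

theorem GenSol.normalizedSol {n : ℕ} {q lam Lam c r R : ℝ} {Ω : Set (EuclideanSpace ℝ (Fin n))}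
    {v : EuclideanSpace ℝ (Fin n) → ℝ} (hsol : GenSol n q lam Lam Ω v) (hΩ : IsOpen Ω)
    (hcoin : coin Ω v = {0}) (hd : DeepSections Ω v c)
    (T : EuclideanSpace ℝ (Fin n) ≃L[ℝ] EuclideanSpace ℝ (Fin n))
    (hin : ∀ y, ‖y‖ < r → y ∈ T '' Ω ∧ v (T.symm y) ≤ 1)
    (hout : ∀ y ∈ T '' Ω, v (T.symm y) ≤ 1 → ‖y‖ < R) :
    NormalizedSol (T '' Ω) (fun y => v (T.symm y)) c r R := by
  have h0 : (0 : EuclideanSpace ℝ (Fin n)) ∈ coin Ω v := by rw [hcoin]; rfl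
  have hmaps : ∀ y ∈ T '' Ω, T.symm y ∈ Ω := by
    rintro _ ⟨x, hx, rfl⟩
    rwa [T.symm_apply_apply]
  exact
    { isOpen := T.toHomeomorph.isOpenMap _ hΩ
      cont := hsol.1.comp T.symm.continuous.continuousOn hmaps
      conv := by
        refine ⟨hsol.2.1.1.is_linear_image T.toLinearEquiv.toLinearMap.isLinear, ?_⟩
        intro x hx y hy a b ha hb hab
        simp only [map_add, map_smul]
        exact hsol.2.1.2 (hmaps x hx) (hmaps y hy) ha hb hab
      nonneg := fun y hy => hsol.2.2.1 _ (hmaps y hy)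
      zero_mem := ⟨0, h0.1, map_zero T⟩
      map_zero := by simpa using h0.2
      eq_zero := fun y hy hv => by
        have h1 : T.symm y ∈ coin Ω v := ⟨hmaps y hy, hv⟩
        rw [hcoin] at h1
        exact (map_eq_zero_iff T.symm T.symm.injective).1 h1
      deep := hd.comp_symm T
      inner_ball := hin
      outer_ball := hout }

/-- **`C^{1,α}` regularity when the coincidence set is a single point.**
If `K = {0}` and `S₁ = {v ≤ 1}` is a compact subset of `Ω`, then after a volume-preserving
linear normalization `T`, `B_c(0) ⊆ T(S₁) ⊆ B_C(0)`, the normalized solution `ṽ = v ∘ T⁻¹`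
is `C^{1,α}` on `{ṽ ≤ 1/2}`, and `c|x|^{(1+α)/α} ≤ ṽ(x) ≤ C|x|^{1+α}` in `B_c(0)`, with
`α ∈ (0,1)` and `0 < c < C` depending only on `n, q, λ, Λ`. -/
theorem c1alpha_regularity_single_point_K
    (n : ℕ) (hn : 2 ≤ n) (q lam Lam : ℝ)
    (hq0 : 0 < q) (hqn : q < n) (hlam : 0 < lam) (hlL : lam ≤ Lam) :
    ∃ α c C : ℝ, α ∈ Set.Ioo (0 : ℝ) 1 ∧ 0 < c ∧ c < C ∧
      ∀ (Ω : Set (EuclideanSpace ℝ (Fin n))) (v : EuclideanSpace ℝ (Fin n) → ℝ),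
        IsOpen Ω → Convex ℝ Ω → GenSol n q lam Lam Ω v →
        coin Ω v = {0} →
        IsCompact {x ∈ Ω | v x ≤ 1} →
        ∃ T : EuclideanSpace ℝ (Fin n) ≃L[ℝ] EuclideanSpace ℝ (Fin n),
          |LinearMap.det (T.toLinearEquiv :
              EuclideanSpace ℝ (Fin n) →ₗ[ℝ] EuclideanSpace ℝ (Fin n))| = 1 ∧
          (Metric.ball (0 : EuclideanSpace ℝ (Fin n)) c ⊆ T '' {x ∈ Ω | v x ≤ 1} ∧
            T '' {x ∈ Ω | v x ≤ 1} ⊆ Metric.ball (0 : EuclideanSpace ℝ (Fin n)) C) ∧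
          (∀ y ∈ T '' Ω, v (T.symm y) ≤ 1 / 2 →
            DifferentiableAt ℝ (fun z => v (T.symm z)) y ∧
              |v (T.symm y)| + ‖fderiv ℝ (fun z => v (T.symm z)) y‖ ≤ C) ∧
          (∀ y ∈ T '' Ω, ∀ z ∈ T '' Ω, v (T.symm y) ≤ 1 / 2 → v (T.symm z) ≤ 1 / 2 →
            ‖fderiv ℝ (fun w => v (T.symm w)) y - fderiv ℝ (fun w => v (T.symm w)) z‖
              ≤ C * ‖y - z‖ ^ α) ∧
          (∀ y ∈ Metric.ball (0 : EuclideanSpace ℝ (Fin n)) c,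
            c * ‖y‖ ^ ((1 + α) / α) ≤ v (T.symm y) ∧ v (T.symm y) ≤ C * ‖y‖ ^ (1 + α)) := by
  obtain ⟨c₀, hc₀, hdeep⟩ := exists_deepSections (by omega) hq0 hqn hlam hlL
  obtain ⟨r, R, hr, hnorm⟩ := exists_normalization (by omega) hq0 hqn hlam hlL hc₀.1
  obtain ⟨α, c, C, hα, hc, hcC, hcr, hRC, hreg⟩ :=
    exists_regularity (E := EuclideanSpace ℝ (Fin n)) hc₀ hr R
  refine ⟨α, c, C, hα, hc, hcC, fun Ω v hΩ _ hsol hcoin hcomp => ?_⟩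
  have hd := hdeep Ω v hΩ hsol hcoin hcomp
  obtain ⟨T, hdet, hin, hout⟩ := hnorm Ω v hΩ hsol hcoin hcomp hd
  obtain ⟨h1, h2, h3⟩ := hreg _ _ (hsol.normalizedSol hΩ hcoin hd T hin hout)
  refine ⟨T, hdet, ⟨fun y hy => ?_, ?_⟩, h1, h2, fun y hy => h3 y (mem_ball_zero_iff.1 hy)⟩
  · have hy' := hin y ((mem_ball_zero_iff.1 hy).trans_le hcr)
    obtain ⟨⟨x, hx, rfl⟩, hxv⟩ := hy'
    rw [T.symm_apply_apply] at hxv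
    exact mem_image_of_mem T ⟨hx, hxv⟩
  · rintro _ ⟨x, ⟨hx, hxv⟩, rfl⟩
    rw [mem_ball_zero_iff]
    exact (hout _ (mem_image_of_mem T hx) (by rwa [T.symm_apply_apply])).trans_le hRC
end
end

section
/- Let n ≥ 2, 0 ≤ q < n and M > 0. There exists a constant C, depending only on n, q and M, with the following property. Let Ω ⊆ ℝⁿ be a bounded open set and let w be a real-valued function that is four times continuously differentiable on an open neighborhood of the closure of Ω and convex on Ω, such that: w = 0 on ∂Ω; |∇w(x)| ≤ M for all x ∈ Ω; x·∇w(x) − w(x) > 0 for all x ∈ Ω; and det D²w(x) = (x·∇w(x) − w(x))^{−q} for all x ∈ Ω. Then (−w(x)) · ‖D²w(x)‖ ≤ C for every x ∈ Ω, where ‖D²w(x)‖ denotes the operator norm (largest eigenvalue) of the Hessian matrix of w at x. -/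
open MeasureTheory Set Metric
open scoped RealInnerProductSpace

noncomputable section

/-- The Hessian of `w` at `x`, as a continuous bilinear form. -/
def hess {n : ℕ} (w : EuclideanSpace ℝ (Fin n) → ℝ) (x : EuclideanSpace ℝ (Fin n)) :
    EuclideanSpace ℝ (Fin n) →L[ℝ] EuclideanSpace ℝ (Fin n) →L[ℝ] ℝ :=
  fderiv ℝ (fderiv ℝ w) x

/-- The Hessian matrix `(∂²w/∂x_i∂x_j)` of `w` at `x`. -/
def hessMatrix {n : ℕ} (w : EuclideanSpace ℝ (Fin n) → ℝ) (x : EuclideanSpace ℝ (Fin n)) :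
    Matrix (Fin n) (Fin n) ℝ :=
  Matrix.of fun i j => hess w x (EuclideanSpace.single i 1) (EuclideanSpace.single j 1)

open Filter Topology Matrix

/-- Necessary conditions of first and second order at a local maximum on the line. -/
theorem IsLocalMax.hasDerivAt_second_nonpos {f g : ℝ → ℝ} {c x : ℝ}
    (hf : ∀ᶠ t in 𝓝 x, HasDerivAt f (g t) t) (hg : HasDerivAt g c x) (hmax : IsLocalMax f x) :
    g x = 0 ∧ c ≤ 0 := by
  have h0 : g x = 0 := hmax.hasDerivAt_eq_zero hf.self_of_nhds
  refine ⟨h0, ?_⟩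
  have hd : deriv f =ᶠ[𝓝 x] g := hf.mono fun t ht => ht.deriv
  by_contra! hc
  have hmin : IsLocalMin f x := by
    refine isLocalMin_of_deriv_deriv_pos ?_ (by rw [hd.self_of_nhds, h0])
      hf.self_of_nhds.continuousAt
    rw [hd.deriv_eq, hg.deriv]
    exact hc
  have hconst : f =ᶠ[𝓝 x] fun _ => f x := by
    filter_upwards [hmax, hmin] with t h1 h2 using le_antisymm h1 h2
  have hg0 : g =ᶠ[𝓝 x] fun _ => 0 := by
    filter_upwards [hd, hconst.deriv] with t h1 h2
    rw [← h1, h2, deriv_const]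
  have : c = 0 := by
    rw [← hg.deriv, hg0.deriv_eq, deriv_const]
  linarith

/-- First- and second-order conditions at a local maximum of `-a * b * exp (v ^ 2 / 2)`. -/
theorem IsLocalMax.neg_mul_mul_exp_second_order {a b v a1 b1 v1 : ℝ → ℝ} {a2 b2 v2 : ℝ}
    (ha : ∀ᶠ t in 𝓝 0, HasDerivAt a (a1 t) t) (ha1 : HasDerivAt a1 a2 0)
    (hb : ∀ᶠ t in 𝓝 0, HasDerivAt b (b1 t) t) (hb1 : HasDerivAt b1 b2 0)
    (hv : ∀ᶠ t in 𝓝 0, HasDerivAt v (v1 t) t) (hv1 : HasDerivAt v1 v2 0)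
    (ha0 : a 0 < 0) (hb0 : 0 < b 0)
    (hmax : IsLocalMax (fun t => -a t * b t * Real.exp (v t ^ 2 / 2)) 0) :
    a1 0 / a 0 + b1 0 / b 0 + v 0 * v1 0 = 0 ∧
      (a2 / a 0 - a1 0 ^ 2 / a 0 ^ 2) + (b2 / b 0 - b1 0 ^ 2 / b 0 ^ 2)
        + (v1 0 ^ 2 + v 0 * v2) ≤ 0 := by
  have hae : ∀ᶠ t in 𝓝 0, a t < 0 :=
    ha.self_of_nhds.continuousAt.eventually_lt continuousAt_const ha0
  have hbe : ∀ᶠ t in 𝓝 0, 0 < b t :=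
    continuousAt_const.eventually_lt hb.self_of_nhds.continuousAt hb0
  have hmax' : IsLocalMax (fun t => Real.log (a t) + Real.log (b t) + v t ^ 2 / 2) 0 := by
    filter_upwards [hmax, hae, hbe] with t ht hat hbt
    have key : ∀ x y z : ℝ, x < 0 → 0 < y →
        Real.log x + Real.log y + z ^ 2 / 2 = Real.log (-x * y * Real.exp (z ^ 2 / 2)) := by
      intro x y z hx hy
      rw [Real.log_mul (by nlinarith) (Real.exp_ne_zero _), Real.log_mul (by linarith) hy.ne',
        Real.log_exp, Real.log_neg_eq_log]
    rw [key _ _ _ hat hbt, key _ _ _ ha0 hb0]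
    refine Real.log_le_log ?_ ht
    have : 0 < -a t := by linarith
    positivity
  have hf : ∀ᶠ t in 𝓝 0, HasDerivAt (fun t => Real.log (a t) + Real.log (b t) + v t ^ 2 / 2)
      (a1 t / a t + b1 t / b t + v t * v1 t) t := by
    filter_upwards [ha, hb, hv, hae, hbe] with t h1 h2 h3 h4 h5
    have := ((h1.log h4.ne).add (h2.log h5.ne')).add ((h3.pow 2).div_const 2)
    refine this.congr_deriv ?_
    push_cast
    ring
  have hg := ((ha1.div ha.self_of_nhds ha0.ne).add (hb1.div hb.self_of_nhds hb0.ne')).add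
    (hv.self_of_nhds.mul hv1)
  obtain ⟨h1, h2⟩ := hmax'.hasDerivAt_second_nonpos hf hg
  refine ⟨h1, le_trans (le_of_eq ?_) h2⟩
  have := ha0.ne
  have := hb0.ne'
  field_simp

/-- A determinant is differentiated row by row. -/
theorem Matrix.hasDerivAt_det {ι : Type*} [Fintype ι] [DecidableEq ι] {B : ℝ → Matrix ι ι ℝ}
    {B' : Matrix ι ι ℝ} {t : ℝ} (hB : ∀ i j, HasDerivAt (fun t => B t i j) (B' i j) t) :
    HasDerivAt (fun t => (B t).det) (∑ i, ((B t).updateRow i (B' i)).det) t := by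
  let D : ContinuousMultilinearMap ℝ (fun _ : ι => ι → ℝ) ℝ :=
    ⟨(Matrix.detRowAlternating (n := ι) (R := ℝ)).toMultilinearMap,
      Continuous.matrix_det (A := fun M : Matrix ι ι ℝ => M) continuous_id⟩
  have hB' : HasDerivAt (F := ι → ι → ℝ) (fun t i j => B t i j) (fun i j => B' i j) t :=
    hasDerivAt_pi.2 fun i => hasDerivAt_pi.2 (hB i)
  have h := (D.hasFDerivAt fun i j => B t i j).comp_hasDerivAt t hB'
  exact h.congr_deriv (ContinuousMultilinearMap.linearDeriv_apply D _ _)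

theorem Matrix.det_updateRow_one {ι : Type*} [Fintype ι] [DecidableEq ι] (i : ι) (v : ι → ℝ) :
    ((1 : Matrix ι ι ℝ).updateRow i v).det = v i := by
  rw [← Matrix.cramer_transpose_apply, Matrix.transpose_one, Matrix.cramer_one]
  rfl

theorem Matrix.det_updateRow_updateRow_one {ι : Type*} [Fintype ι] [DecidableEq ι] {i j : ι}
    (hij : i ≠ j) (v w : ι → ℝ) :
    (((1 : Matrix ι ι ℝ).updateRow i v).updateRow j w).det = v i * w j - v j * w i := by
  let P : Matrix ι (Fin 2) ℝ := Matrix.of fun a => ![(1 : Matrix ι ι ℝ) a i, (1 : Matrix ι ι ℝ) a j]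
  let R : Matrix (Fin 2) ι ℝ := Matrix.of fun k a =>
    ![v a - (1 : Matrix ι ι ℝ) i a, w a - (1 : Matrix ι ι ℝ) j a] k
  have h : ((1 : Matrix ι ι ℝ).updateRow i v).updateRow j w = 1 + P * R := by
    ext a b
    by_cases h1 : a = j
    · subst h1
      simp [P, R, Matrix.mul_apply, Matrix.one_apply_ne hij.symm]
    · by_cases h2 : a = i
      · subst h2
        simp [P, R, Matrix.mul_apply, Matrix.updateRow_ne h1, Matrix.one_apply_ne hij]
      · simp [P, R, Matrix.mul_apply, Matrix.updateRow_ne h1, Matrix.updateRow_ne h2,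
          Matrix.one_apply_ne h1, Matrix.one_apply_ne h2]
  have h2 : 1 + R * P = !![v i, v j; w i, w j] := by
    ext a b
    fin_cases a <;> fin_cases b <;>
      simp [P, R, Matrix.mul_apply, Matrix.one_apply, hij, hij.symm]
  rw [h, Matrix.det_one_add_mul_comm, h2, Matrix.det_fin_two_of]

/-- Second derivative of a determinant at a parameter where the matrix is the identity. -/
theorem Matrix.hasDerivAt_det_second {ι : Type*} [Fintype ι] [DecidableEq ι]
    {B B1 : ℝ → Matrix ι ι ℝ} {B2 : Matrix ι ι ℝ} {t : ℝ}
    (hB : ∀ i j, HasDerivAt (fun t => B t i j) (B1 t i j) t)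
    (hB1 : ∀ i j, HasDerivAt (fun t => B1 t i j) (B2 i j) t) (h1 : B t = 1) :
    HasDerivAt (fun t => ∑ i, ((B t).updateRow i (B1 t i)).det)
      (B2.trace + (B1 t).trace ^ 2 - ∑ i, ∑ j, B1 t i j * B1 t j i) t := by
  have key : ∀ i, HasDerivAt (fun t => ((B t).updateRow i (B1 t i)).det)
      (B2 i i + ∑ j, (B1 t i i * B1 t j j - B1 t i j * B1 t j i)) t := by
    intro i
    have h := Matrix.hasDerivAt_det (B := fun t => (B t).updateRow i (B1 t i))
      (B' := (B1 t).updateRow i (B2 i)) (t := t) (by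
        intro k l
        by_cases hk : k = i
        · subst hk
          simpa using hB1 k l
        · simpa [Matrix.updateRow_ne hk] using hB k l)
    convert h using 1
    rw [h1, ← Finset.add_sum_erase _ _ (Finset.mem_univ i),
      ← Finset.add_sum_erase _ _ (Finset.mem_univ i)]
    rw [sub_self, zero_add, Matrix.updateRow_self, Matrix.updateRow_idem,
      Matrix.det_updateRow_one]
    congr 1
    refine Finset.sum_congr rfl fun j hj => ?_
    have hji : j ≠ i := Finset.ne_of_mem_erase hj
    rw [Matrix.updateRow_ne hji, Matrix.det_updateRow_updateRow_one hji.symm]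
  refine (HasDerivAt.fun_sum (u := Finset.univ) fun i _ => key i).congr_deriv ?_
  rw [Finset.sum_add_distrib]
  simp_rw [Finset.sum_sub_distrib]
  rw [show B2.trace = ∑ i, B2 i i from rfl, show (B1 t).trace = ∑ i, B1 t i i from rfl, sq,
    Finset.sum_mul_sum]
  ring

/-- The first and second differentiated forms of the equation `det B = κ * u ^ (-q)` at a
parameter where `B` is the identity. -/
theorem Matrix.trace_of_det_eq_rpow {ι : Type*} [Fintype ι] [DecidableEq ι]
    {B B1 : ℝ → Matrix ι ι ℝ} {B2 : Matrix ι ι ℝ} {u u1 : ℝ → ℝ} {u2 κ q : ℝ}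
    (hB : ∀ i j, ∀ᶠ t in 𝓝 0, HasDerivAt (fun t => B t i j) (B1 t i j) t)
    (hB1 : ∀ i j, HasDerivAt (fun t => B1 t i j) (B2 i j) 0) (h1 : B 0 = 1)
    (hu : ∀ᶠ t in 𝓝 0, HasDerivAt u (u1 t) t) (hu1 : HasDerivAt u1 u2 0) (hu0 : 0 < u 0)
    (hdet : ∀ᶠ t in 𝓝 0, (B t).det = κ * u t ^ (-q)) :
    (B1 0).trace = -q * (u1 0 / u 0) ∧
      B2.trace = ∑ i, ∑ j, B1 0 i j * B1 0 j i - q * (u2 / u 0 - u1 0 ^ 2 / u 0 ^ 2) := by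
  have hB' : ∀ᶠ t in 𝓝 0, ∀ i j, HasDerivAt (fun t => B t i j) (B1 t i j) t := by
    simpa only [eventually_all] using hB
  have hue : ∀ᶠ t in 𝓝 0, 0 < u t :=
    continuousAt_const.eventually_lt hu.self_of_nhds.continuousAt hu0
  have hd1 : ∀ᶠ t in 𝓝 0, ∑ i, ((B t).updateRow i (B1 t i)).det
      = (B t).det * (-q * (u1 t / u t)) := by
    filter_upwards [hB', hu, hue, hdet.eventually_nhds] with t h2 h3 h4 h5
    have e1 := Matrix.hasDerivAt_det h2
    have e2 := (h3.rpow_const (p := -q) (Or.inl h4.ne')).const_mul κ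
    rw [(e1.congr_of_eventuallyEq (h5.mono fun _ h => h.symm)).unique e2, h5.self_of_nhds,
      Real.rpow_sub_one h4.ne']
    ring
  have s1 := Matrix.hasDerivAt_det_second hB'.self_of_nhds hB1 h1
  have s2 := (Matrix.hasDerivAt_det hB'.self_of_nhds).mul
    ((hu1.div hu.self_of_nhds hu0.ne').const_mul (-q))
  have t1 : (B1 0).trace = -q * (u1 0 / u 0) := by
    have := hd1.self_of_nhds
    simp only [h1, Matrix.det_updateRow_one, Matrix.det_one, one_mul] at this
    exact this
  have t2 := s1.unique (s2.congr_of_eventuallyEq hd1)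
  refine ⟨t1, ?_⟩
  simp only [h1, Matrix.det_updateRow_one, Matrix.det_one, Pi.div_apply] at t2
  have t3 : ∑ i, B1 0 i i = -q * (u1 0 / u 0) := t1
  rw [t3, t1] at t2
  have := hu0.ne'
  field_simp at t2 ⊢
  linarith

/-- The algebraic core of Pogorelov's estimate. The quantities are the components, in a basis
orthonormal for the Hessian whose member of index `o` is parallel to the direction `ξ`, of the
derivatives of the solution at a maximum point. -/
theorem pogorelov_algebra {ι : Type*} [Fintype ι] [DecidableEq ι] (o : ι)
    {p τ Q K : ι → ℝ} {T : ι → ι → ℝ} {z s r u u1 q V Y : ℝ}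
    (hz : z < 0) (hr : 0 < r) (hs : s = r ^ 2) (hu : 0 < u) (hq : 0 ≤ q)
    (hT : ∀ a b, T a b = T b a) (hK : ∀ a, K a = if a = o then r else 0)
    (hτ : ∀ a, τ a = r * T o a) (hp : p o = V / r)
    (h1 : ∀ a, p a / z + τ a / s + V * K a = 0)
    (h2 : ∀ a, (1 / z - p a ^ 2 / z ^ 2) + (Q a / s - τ a ^ 2 / s ^ 2)
      + (K a ^ 2 + V * T a a) ≤ 0)
    (hx : (u + z) / z + Y / s + V * u1 = 0)
    (htr : ∑ a, T a a = -q * (u1 / u))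
    (hQ : ∑ a, Q a = ∑ a, ∑ b, T a b * T b a - q * ((Y + s) / u - u1 ^ 2 / u ^ 2)) :
    (-z * s) ^ 2 ≤ (Fintype.card ι + q) * (-z * s) + V ^ 2 := by
  have hs0 : 0 < s := by rw [hs]; positivity
  have hTT : 2 * ∑ a, T o a ^ 2 - T o o ^ 2 ≤ ∑ a, ∑ b, T a b * T b a := by
    have e : 2 * ∑ a, T o a ^ 2 - T o o ^ 2 = ∑ a, ∑ b,
        ((if a = o then T o b ^ 2 else 0) + (if b = o then T o a ^ 2 else 0)
          - (if a = o then if b = o then T o o ^ 2 else 0 else 0)) := by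
      have e1 : ∑ a, ∑ b, (if a = o then T o b ^ 2 else 0) = ∑ b, T o b ^ 2 := by
        rw [Finset.sum_comm]; simp
      simp only [Finset.sum_sub_distrib, Finset.sum_add_distrib, e1]
      simp only [Finset.sum_ite_eq', Finset.mem_univ, if_true, Finset.sum_ite_irrel,
        Finset.sum_const_zero]
      ring
    rw [e]
    refine Finset.sum_le_sum fun a _ => Finset.sum_le_sum fun b _ => ?_
    rw [hT b a]
    by_cases ha : a = o <;> by_cases hb : b = o
    · subst ha; subst hb; simp [sq]
    · subst ha; simp [hb, sq]
    · subst hb; simp [ha, sq, hT a b]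
    · simp [ha, hb, mul_self_nonneg]
  have hpp : ∀ a, p a ^ 2 / z ^ 2 = T o a ^ 2 / s
      + if a = o then V ^ 2 / (s * z ^ 2) - T o o ^ 2 / s else 0 := by
    intro a
    by_cases ha : a = o
    · subst ha
      rw [hp, if_pos rfl, hs]
      field_simp
      ring
    · have := h1 a
      rw [hK a, if_neg ha, hτ a, mul_zero, add_zero] at this
      have h3 : p a / z = -(r * T o a / s) := by linarith
      rw [if_neg ha, ← div_pow, h3, hs]
      field_simp
      ring
  have hττ : ∀ a, τ a ^ 2 / s ^ 2 = T o a ^ 2 / s := by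
    intro a
    rw [hτ a, hs]
    field_simp
  have hKK : ∀ a, K a ^ 2 = if a = o then s else 0 := by
    intro a
    rw [hK a, hs]
    split_ifs <;> simp
  have hsum := Finset.sum_nonpos fun a (_ : a ∈ Finset.univ) => h2 a
  simp only [hpp, hττ, hKK, Finset.sum_add_distrib, Finset.sum_sub_distrib, ← Finset.sum_div,
    ← Finset.mul_sum, htr, hQ, Finset.sum_ite_eq', Finset.mem_univ, if_true, Finset.sum_const,
    Finset.card_univ, nsmul_eq_mul] at hsum
  have hY : Y = -s * ((u + z) / z + V * u1) := by
    have : Y / s = -((u + z) / z + V * u1) := by linarith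
    field_simp at this ⊢
    linarith
  have hdiv : (2 * ∑ a, T o a ^ 2 - T o o ^ 2) / s ≤ (∑ a, ∑ b, T a b * T b a) / s := by gcongr
  have hq1 : 0 ≤ q * (u1 ^ 2 / u ^ 2) / s := by positivity
  have hmain : (Fintype.card ι + q) / z - V ^ 2 / (s * z ^ 2) + s ≤ 0 := by
    have e : q * ((Y + s) / u) / s + V * (q * (u1 / u)) = - (q / z) := by
      rw [hY]
      have := hz.ne
      field_simp
      ring
    rw [sub_div, mul_div_assoc] at hdiv
    have e2 : ∀ x : ℝ, (x - q * ((Y + s) / u - u1 ^ 2 / u ^ 2)) / s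
        = x / s - q * ((Y + s) / u) / s + q * (u1 ^ 2 / u ^ 2) / s := by
      intro x; ring
    rw [e2] at hsum
    have e3 : (Fintype.card ι + q) / z = Fintype.card ι * (1 / z) + q / z := by ring
    have e4 : (Fintype.card ι : ℝ) * 1 / z = Fintype.card ι * (1 / z) := by ring
    have e5 : V * (-q * (u1 / u)) = -(V * (q * (u1 / u))) := by ring
    rw [e4, e5] at hsum
    rw [e3]
    generalize V * (q * (u1 / u)) = A1 at *
    generalize q * ((Y + s) / u) / s = A2 at *
    generalize q * (u1 ^ 2 / u ^ 2) / s = A3 at *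
    linarith
  have hm := mul_le_mul_of_nonneg_right hmain (show 0 ≤ s * z ^ 2 by positivity)
  have e : ((Fintype.card ι + q) / z - V ^ 2 / (s * z ^ 2) + s) * (s * z ^ 2)
      = (Fintype.card ι + q) * (z * s) - V ^ 2 + (z * s) ^ 2 := by
    have := hz.ne
    field_simp
  rw [e] at hm
  linarith

section Lines

variable {E F : Type*} [NormedAddCommGroup E] [NormedSpace ℝ E] [NormedAddCommGroup F]
  [NormedSpace ℝ F]

theorem hasDerivAt_line (x e : E) (t : ℝ) : HasDerivAt (fun t : ℝ => x + t • e) e t := by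
  simpa using ((hasDerivAt_id t).smul_const e).const_add x

theorem tendsto_line (x e : E) : Tendsto (fun t : ℝ => x + t • e) (𝓝 0) (𝓝 x) := by
  simpa [ContinuousAt] using (hasDerivAt_line x e 0).continuousAt

theorem ContDiffAt.eventually_hasDerivAt_line {G : E → F} {x : E} (hG : ContDiffAt ℝ 1 G x)
    (e : E) :
    ∀ᶠ t in 𝓝 (0 : ℝ), HasDerivAt (fun t : ℝ => G (x + t • e)) (fderiv ℝ G (x + t • e) e) t := by
  filter_upwards [(tendsto_line x e).eventually (hG.eventually (by simp))] with t ht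
  exact (ht.differentiableAt one_ne_zero).hasFDerivAt.comp_hasDerivAt t (hasDerivAt_line x e t)

theorem ContDiffAt.hasDerivAt_line_second {G : E → F} {x : E} (hG : ContDiffAt ℝ 2 G x)
    (e : E) :
    HasDerivAt (fun t : ℝ => fderiv ℝ G (x + t • e) e) (fderiv ℝ (fderiv ℝ G) x e e) 0 := by
  have h := ((hG.fderiv_right (m := 1) (by norm_num)).eventually_hasDerivAt_line e).self_of_nhds
  simpa using h.clm_apply (hasDerivAt_const 0 e)

end Lines

section Hessian

variable {n : ℕ} {w : EuclideanSpace ℝ (Fin n) → ℝ} {x : EuclideanSpace ℝ (Fin n)}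

theorem hess_symm (hw : ContDiffAt ℝ 2 w x) (a b : EuclideanSpace ℝ (Fin n)) :
    hess w x a b = hess w x b a :=
  hw.isSymmSndFDerivAt (by simp) a b

theorem ContDiffAt.hess {k m : WithTop ℕ∞} (hw : ContDiffAt ℝ k w x) (hk : m + 2 ≤ k) :
    ContDiffAt ℝ m (hess w) x :=
  (hw.fderiv_right (m := m + 1) (by rw [add_assoc, one_add_one_eq_two]; exact hk)).fderiv_right
    le_rfl

theorem fderiv_hess_swap_left (hw : ContDiffAt ℝ 3 w x) (a b c : EuclideanSpace ℝ (Fin n)) :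
    fderiv ℝ (hess w) x a b c = fderiv ℝ (hess w) x b a c :=
  congrArg (· c) ((hw.fderiv_right (m := 2) (by norm_num)).isSymmSndFDerivAt (by simp) a b)

theorem fderiv_hess_apply (hw : ContDiffAt ℝ 3 w x) (a b c : EuclideanSpace ℝ (Fin n)) :
    fderiv ℝ (fun y => hess w y b c) x a = fderiv ℝ (hess w) x a b c := by
  have h := ((hw.hess (m := 1) (by norm_num)).differentiableAt one_ne_zero).hasFDerivAt
  simpa using congrArg (· a)
    ((h.clm_apply (hasFDerivAt_const b x)).clm_apply (hasFDerivAt_const c x)).fderiv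

theorem fderiv_hess_swap_right (hw : ContDiffAt ℝ 3 w x) (a b c : EuclideanSpace ℝ (Fin n)) :
    fderiv ℝ (hess w) x a b c = fderiv ℝ (hess w) x a c b := by
  rw [← fderiv_hess_apply hw, ← fderiv_hess_apply hw]
  have : (fun y => hess w y b c) =ᶠ[𝓝 x] fun y => hess w y c b := by
    filter_upwards [hw.eventually (by simp)] with y hy
    exact hess_symm (hy.of_le (by norm_num)) b c
  rw [this.fderiv_eq]

set_option maxSynthPendingDepth 3 in
theorem fderiv_fderiv_hess_apply (hw : ContDiffAt ℝ 4 w x) (a b c d : EuclideanSpace ℝ (Fin n)) :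
    fderiv ℝ (fun y => fderiv ℝ (hess w) y b c d) x a
      = fderiv ℝ (fderiv ℝ (hess w)) x a b c d := by
  have h := (((hw.hess (m := 2) (by norm_num)).fderiv_right (m := 1)
    (by norm_num)).differentiableAt one_ne_zero).hasFDerivAt
  simpa using congrArg (· a) (((h.clm_apply (hasFDerivAt_const b x)).clm_apply
    (hasFDerivAt_const c x)).clm_apply (hasFDerivAt_const d x)).fderiv

set_option maxSynthPendingDepth 3 in
theorem fderiv_fderiv_hess_swap (hw : ContDiffAt ℝ 4 w x) (a b : EuclideanSpace ℝ (Fin n)) :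
    fderiv ℝ (fderiv ℝ (hess w)) x a a b b = fderiv ℝ (fderiv ℝ (hess w)) x b b a a := by
  have h3 : ∀ᶠ y in 𝓝 x, ContDiffAt ℝ 3 w y :=
    (hw.eventually (by simp)).mono fun y hy => hy.of_le (by norm_num)
  have s1 : ∀ a b c d, fderiv ℝ (fderiv ℝ (hess w)) x a b c d
      = fderiv ℝ (fderiv ℝ (hess w)) x b a c d := fun a b c d =>
    congrArg (· c d) ((hw.hess (m := 2) (by norm_num)).isSymmSndFDerivAt (by simp) a b)
  have s2 : ∀ a b c d, fderiv ℝ (fderiv ℝ (hess w)) x a b c d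
      = fderiv ℝ (fderiv ℝ (hess w)) x a c b d := by
    intro a b c d
    rw [← fderiv_fderiv_hess_apply hw, ← fderiv_fderiv_hess_apply hw,
      Filter.EventuallyEq.fderiv_eq (h3.mono fun y hy => fderiv_hess_swap_left hy b c d)]
  have s3 : ∀ a b c d, fderiv ℝ (fderiv ℝ (hess w)) x a b c d
      = fderiv ℝ (fderiv ℝ (hess w)) x a b d c := by
    intro a b c d
    rw [← fderiv_fderiv_hess_apply hw, ← fderiv_fderiv_hess_apply hw,
      Filter.EventuallyEq.fderiv_eq (h3.mono fun y hy => fderiv_hess_swap_right hy b c d)]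
  rw [s2 a a b b, s1 a b a b, s3 b a a b, s2 b a b a]

theorem hess_self_nonneg {Ω : Set (EuclideanSpace ℝ (Fin n))} (hΩ : IsOpen Ω)
    (hc : ConvexOn ℝ Ω w) (hw : ∀ y ∈ Ω, ContDiffAt ℝ 2 w y) (hx : x ∈ Ω)
    (e : EuclideanSpace ℝ (Fin n)) : 0 ≤ hess w x e e := by
  let L : ℝ →ᵃ[ℝ] EuclideanSpace ℝ (Fin n) := AffineMap.lineMap x (x + e)
  have hL : ∀ t, L t = x + t • e := fun t => by
    simp [L, AffineMap.lineMap_apply, add_comm]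
  have hconv := hc.comp_affineMap L
  have hd : ∀ t ∈ L ⁻¹' Ω, HasDerivAt (w ∘ L) (fderiv ℝ w (x + t • e) e) t := by
    intro t ht
    have h1 : ContDiffAt ℝ 2 w (x + t • e) := by
      rw [← hL]; exact hw _ ht
    have := (h1.differentiableAt two_ne_zero).hasFDerivAt.comp_hasDerivAt t (hasDerivAt_line x e t)
    exact this.congr_of_eventuallyEq (Eventually.of_forall fun s => by simp [hL])
  have hmono := hconv.monotoneOn_deriv fun t ht => (hd t ht).differentiableAt
  have hopen : L ⁻¹' Ω ∈ 𝓝 (0 : ℝ) := by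
    have := (tendsto_line x e).eventually (hΩ.mem_nhds hx)
    filter_upwards [this] with t ht
    rw [mem_preimage, hL]
    exact ht
  have hderiv : HasDerivAt (deriv (w ∘ L)) (hess w x e e) 0 := by
    refine ((hw x hx).hasDerivAt_line_second e).congr_of_eventuallyEq ?_
    filter_upwards [hopen] with t ht using (hd t ht).deriv
  refine hderiv.hasDerivWithinAt.nonneg_of_monotoneOn ?_ hmono
  exact accPt_principal_iff_nhdsWithin.2 (by
    rw [sdiff_eq, inter_comm, nhdsWithin_inter_of_mem' (mem_nhdsWithin_of_mem_nhds hopen)]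
    infer_instance)

theorem euclidean_eq_sum (a : EuclideanSpace ℝ (Fin n)) :
    a = ∑ i, a i • EuclideanSpace.single i (1 : ℝ) := by
  ext j
  simp [Pi.single_apply]

theorem hess_apply_eq_dotProduct (a b : EuclideanSpace ℝ (Fin n)) :
    hess w x a b = a.ofLp ⬝ᵥ hessMatrix w x *ᵥ b.ofLp := by
  conv_lhs => rw [euclidean_eq_sum a, euclidean_eq_sum b]
  simp only [map_sum, map_smul, _root_.sum_apply, _root_.smul_apply,
    smul_eq_mul, dotProduct, Matrix.mulVec, hessMatrix, Matrix.of_apply, Finset.mul_sum]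
  rw [Finset.sum_comm]
  refine Finset.sum_congr rfl fun i _ => Finset.sum_congr rfl fun j _ => ?_
  ring

open scoped MatrixOrder Matrix.Norms.L2Operator in
/-- A basis which is orthonormal for the Hessian at `x` and contains a multiple of `ξ`. -/
theorem exists_hess_orthonormal (o : Fin n) (hw : ContDiffAt ℝ 2 w x)
    (hpsd : ∀ v, 0 ≤ hess w x v v) (hdet : (hessMatrix w x).det ≠ 0)
    {ξ : EuclideanSpace ℝ (Fin n)} {r : ℝ} (hr : 0 < r) (hξ : hess w x ξ ξ = r ^ 2) :
    ∃ e : Fin n → EuclideanSpace ℝ (Fin n), e o = r⁻¹ • ξ ∧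
      ∀ a b, hess w x (e a) (e b) = (1 : Matrix (Fin n) (Fin n) ℝ) a b := by
  have hM : (hessMatrix w x).PosSemidef := by
    refine Matrix.PosSemidef.of_dotProduct_mulVec_nonneg ?_ fun v => ?_
    · ext i j
      simpa [hessMatrix] using hess_symm hw _ _
    · simpa [hess_apply_eq_dotProduct] using hpsd (WithLp.toLp 2 v)
  obtain ⟨B, hB⟩ := CStarAlgebra.nonneg_iff_eq_star_mul_self.1 hM.nonneg
  have hBdet : IsUnit B.det := by
    rw [isUnit_iff_ne_zero]
    intro h
    rw [hB, Matrix.det_mul, h, mul_zero] at hdet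
    exact hdet rfl
  have hin : ∀ a b : EuclideanSpace ℝ (Fin n), hess w x a b
      = ⟪(WithLp.toLp 2 (B *ᵥ a.ofLp) : EuclideanSpace ℝ (Fin n)),
        WithLp.toLp 2 (B *ᵥ b.ofLp)⟫ := by
    intro a b
    rw [hess_apply_eq_dotProduct, hB, EuclideanSpace.inner_toLp_toLp, star_eq_conjTranspose,
      ← Matrix.mulVec_mulVec, Matrix.dotProduct_mulVec, Matrix.vecMul_conjTranspose, star_trivial,
      star_trivial, dotProduct_comm]
    simp
  let η : EuclideanSpace ℝ (Fin n) := WithLp.toLp 2 (B *ᵥ (r⁻¹ • ξ).ofLp)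
  have hη : ‖η‖ = 1 := by
    have : ‖η‖ ^ 2 = 1 := by
      rw [← real_inner_self_eq_norm_sq, ← hin]
      simp only [map_smul, _root_.smul_apply, hξ, smul_eq_mul]
      field_simp
    rwa [pow_eq_one_iff_of_nonneg (norm_nonneg η) two_ne_zero] at this
  obtain ⟨O, hO⟩ := Orthonormal.exists_orthonormalBasis_extension_of_card_eq (𝕜 := ℝ)
    (E := EuclideanSpace ℝ (Fin n)) (ι := Fin n) (by simp) (v := fun _ => η) (s := {o}) (by
      rw [orthonormal_iff_ite]
      rintro ⟨i, rfl⟩ ⟨j, rfl⟩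
      simp [hη])
  refine ⟨fun a => WithLp.toLp 2 (B⁻¹ *ᵥ (O a).ofLp), ?_, fun a b => ?_⟩
  · simp only [hO o rfl]
    simp [η, Matrix.mulVec_mulVec, Matrix.nonsing_inv_mul _ hBdet]
  · rw [hin]
    simp only [Matrix.mulVec_mulVec, Matrix.mul_nonsing_inv _ hBdet, Matrix.one_mulVec,
      WithLp.toLp_ofLp]
    rw [orthonormal_iff_ite.1 O.orthonormal, Matrix.one_apply]

theorem det_hess_apply (e : Fin n → EuclideanSpace ℝ (Fin n)) :
    (Matrix.of fun a b => hess w x (e a) (e b)).det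
      = (Matrix.of fun a i => e a i).det ^ 2 * (hessMatrix w x).det := by
  have : (Matrix.of fun a b => hess w x (e a) (e b)) = (Matrix.of fun a i => e a i)
      * hessMatrix w x * (Matrix.of fun a i => e a i)ᵀ := by
    ext a b
    rw [Matrix.of_apply, hess_apply_eq_dotProduct, Matrix.mul_assoc]
    simp [Matrix.mul_apply, dotProduct, Matrix.mulVec]
  rw [this, Matrix.det_mul, Matrix.det_mul, Matrix.det_transpose]
  ring

end Hessian

section Pogorelov

variable {n : ℕ} {w : EuclideanSpace ℝ (Fin n) → ℝ} {x : EuclideanSpace ℝ (Fin n)}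

theorem eventually_hasDerivAt_fderiv_line (hw : ContDiffAt ℝ 2 w x)
    (d a : EuclideanSpace ℝ (Fin n)) :
    ∀ᶠ t in 𝓝 (0 : ℝ), HasDerivAt (fun t : ℝ => fderiv ℝ w (x + t • d) a)
      (hess w (x + t • d) d a) t := by
  filter_upwards [(hw.fderiv_right (m := 1) (by norm_num)).eventually_hasDerivAt_line d] with t ht
  simpa using! ht.clm_apply (hasDerivAt_const t a)

theorem eventually_hasDerivAt_hess_line (hw : ContDiffAt ℝ 3 w x)
    (d a b : EuclideanSpace ℝ (Fin n)) :
    ∀ᶠ t in 𝓝 (0 : ℝ), HasDerivAt (fun t : ℝ => hess w (x + t • d) a b)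
      (fderiv ℝ (hess w) (x + t • d) d a b) t := by
  filter_upwards [(hw.hess (m := 1) (by norm_num)).eventually_hasDerivAt_line d] with t ht
  simpa using (ht.clm_apply (hasDerivAt_const t a)).clm_apply (hasDerivAt_const t b)

set_option maxSynthPendingDepth 3 in
theorem hasDerivAt_fderiv_hess_line (hw : ContDiffAt ℝ 4 w x)
    (d a b : EuclideanSpace ℝ (Fin n)) :
    HasDerivAt (fun t : ℝ => fderiv ℝ (hess w) (x + t • d) d a b)
      (fderiv ℝ (fderiv ℝ (hess w)) x d d a b) 0 := by
  have h := (hw.hess (m := 2) (by norm_num)).hasDerivAt_line_second d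
  simpa using (h.clm_apply (hasDerivAt_const 0 a)).clm_apply (hasDerivAt_const 0 b)

set_option maxSynthPendingDepth 3 in
/-- Pogorelov's estimate at a maximum point of the auxiliary function
`-w * w_ξξ * exp (w_ξ ^ 2 / 2)`. -/
theorem pogorelov_at_isLocalMax (o : Fin n) {q : ℝ} (hq : 0 ≤ q) (hw : ContDiffAt ℝ 4 w x)
    {ξ : EuclideanSpace ℝ (Fin n)} (hwx : w x < 0) (hξ : 0 < hess w x ξ ξ)
    (hpsd : ∀ v, 0 ≤ hess w x v v) (hu : 0 < fderiv ℝ w x x - w x)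
    (hdet : ∀ᶠ y in 𝓝 x, (hessMatrix w y).det = (fderiv ℝ w y y - w y) ^ (-q))
    (hmax : IsLocalMax
      (fun y => -w y * hess w y ξ ξ * Real.exp (fderiv ℝ w y ξ ^ 2 / 2)) x) :
    (-w x * hess w x ξ ξ) ^ 2 ≤ (n + q) * (-w x * hess w x ξ ξ) + fderiv ℝ w x ξ ^ 2 := by
  have hw1 : ContDiffAt ℝ 1 w x := hw.of_le (by norm_num)
  have hw2 : ContDiffAt ℝ 2 w x := hw.of_le (by norm_num)
  have hw3 : ContDiffAt ℝ 3 w x := hw.of_le (by norm_num)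
  have hdir : ∀ d, (fderiv ℝ w x d / w x + fderiv ℝ (hess w) x d ξ ξ / hess w x ξ ξ
        + fderiv ℝ w x ξ * hess w x d ξ = 0) ∧
      (hess w x d d / w x - fderiv ℝ w x d ^ 2 / w x ^ 2)
        + (fderiv ℝ (fderiv ℝ (hess w)) x d d ξ ξ / hess w x ξ ξ
          - fderiv ℝ (hess w) x d ξ ξ ^ 2 / hess w x ξ ξ ^ 2)
        + (hess w x d ξ ^ 2 + fderiv ℝ w x ξ * fderiv ℝ (hess w) x d d ξ) ≤ 0 := by
    intro d
    have hm : IsLocalMax (fun t : ℝ => -w (x + t • d) * hess w (x + t • d) ξ ξ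
        * Real.exp (fderiv ℝ w (x + t • d) ξ ^ 2 / 2)) 0 := by
      filter_upwards [(tendsto_line x d).eventually hmax] with t ht
      simpa using ht
    have h := hm.neg_mul_mul_exp_second_order (hw1.eventually_hasDerivAt_line d)
      (hw2.hasDerivAt_line_second d) (eventually_hasDerivAt_hess_line hw3 d ξ ξ)
      (hasDerivAt_fderiv_hess_line hw d ξ ξ) (eventually_hasDerivAt_fderiv_line hw2 d ξ)
      (eventually_hasDerivAt_hess_line hw3 d d ξ).self_of_nhds (by simpa using hwx)
      (by simpa using hξ)
    simp only [zero_smul, add_zero] at h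
    exact h
  have hr : 0 < √(hess w x ξ ξ) := Real.sqrt_pos.2 hξ
  have hrs : hess w x ξ ξ = √(hess w x ξ ξ) ^ 2 := (Real.sq_sqrt hξ.le).symm
  generalize √(hess w x ξ ξ) = r at hr hrs
  have hdet0 : (hessMatrix w x).det ≠ 0 := by
    rw [hdet.self_of_nhds]
    exact (Real.rpow_pos_of_pos hu _).ne'
  obtain ⟨e, heo, horth⟩ := exists_hess_orthonormal o hw2 hpsd hdet0 hr hrs
  have hξe : ξ = r • e o := by
    rw [heo, smul_smul, mul_inv_cancel₀ hr.ne', one_smul]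
  have htrace := Matrix.trace_of_det_eq_rpow (q := q)
    (κ := (Matrix.of fun a i => e a i).det ^ 2)
    (B := fun t => Matrix.of fun a b => hess w (x + t • ξ) (e a) (e b))
    (B1 := fun t => Matrix.of fun a b => fderiv ℝ (hess w) (x + t • ξ) ξ (e a) (e b))
    (B2 := Matrix.of fun a b => fderiv ℝ (fderiv ℝ (hess w)) x ξ ξ (e a) (e b))
    (u := fun t => fderiv ℝ w (x + t • ξ) (x + t • ξ) - w (x + t • ξ))
    (u1 := fun t => hess w (x + t • ξ) ξ (x + t • ξ))
    (u2 := fderiv ℝ (hess w) x ξ ξ x + hess w x ξ ξ)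
    (fun a b => eventually_hasDerivAt_hess_line hw3 ξ (e a) (e b))
    (fun a b => hasDerivAt_fderiv_hess_line hw ξ (e a) (e b))
    (by ext a b; simpa using horth a b)
    (by
      filter_upwards [(hw2.fderiv_right (m := 1) (by norm_num)).eventually_hasDerivAt_line ξ,
        hw1.eventually_hasDerivAt_line ξ] with t h1 h2
      simpa using! (h1.clm_apply (hasDerivAt_line x ξ t)).sub h2)
    (by
      have h1 := ((hw.hess (m := 2) (by norm_num)).of_le
        one_le_two).eventually_hasDerivAt_line ξ |>.self_of_nhds
      simpa using (h1.clm_apply (hasDerivAt_const 0 ξ)).clm_apply (hasDerivAt_line x ξ 0))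
    (by simpa using hu)
    (by
      filter_upwards [(tendsto_line x ξ).eventually hdet] with t ht
      rw [det_hess_apply, ht])
  simp only [zero_smul, add_zero] at htrace
  have hD : ∀ c, fderiv ℝ (hess w) x ξ ξ c = r * fderiv ℝ (hess w) x ξ (e o) c := by
    intro c
    calc fderiv ℝ (hess w) x ξ ξ c = fderiv ℝ (hess w) x ξ (r • e o) c := by rw [← hξe]
      _ = _ := by simp
  have h := pogorelov_algebra o (p := fun a => fderiv ℝ w x (e a))
    (τ := fun a => fderiv ℝ (hess w) x (e a) ξ ξ)
    (Q := fun a => fderiv ℝ (fderiv ℝ (hess w)) x (e a) (e a) ξ ξ)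
    (K := fun a => hess w x (e a) ξ) (T := fun a b => fderiv ℝ (hess w) x ξ (e a) (e b))
    (z := w x) (s := hess w x ξ ξ) (r := r) (u := fderiv ℝ w x x - w x) (u1 := hess w x ξ x)
    (q := q) (V := fderiv ℝ w x ξ) (Y := fderiv ℝ (hess w) x ξ ξ x) hwx hr hrs hu hq
    (fun a b => fderiv_hess_swap_right hw3 _ _ _)
    (fun a => by
      calc hess w x (e a) ξ = hess w x (e a) (r • e o) := by rw [← hξe]
        _ = _ := by simp [horth, Matrix.one_apply])
    (fun a => by
      rw [fderiv_hess_swap_left hw3, fderiv_hess_swap_right hw3, hD])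
    (by
      rw [heo, map_smul, smul_eq_mul, div_eq_inv_mul])
    (fun a => (hdir (e a)).1)
    (fun a => by
      have := (hdir (e a)).2
      rwa [horth, Matrix.one_apply_eq, fderiv_hess_swap_right hw3 (e a) (e a) ξ,
        fderiv_hess_swap_left hw3 (e a) ξ (e a)] at this)
    (by
      have := (hdir x).1
      rwa [fderiv_hess_swap_left hw3 x ξ ξ, fderiv_hess_swap_right hw3 ξ x ξ, hess_symm hw2 x ξ,
        show fderiv ℝ w x x = fderiv ℝ w x x - w x + w x by ring] at this)
    htrace.1
    ((Finset.sum_congr rfl fun a _ => fderiv_fderiv_hess_swap hw (e a) ξ).trans htrace.2)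
  simpa using h

theorem norm_hess_le (hw : ContDiffAt ℝ 2 w x) (hpsd : ∀ v, 0 ≤ hess w x v v) {K : ℝ}
    (hK : 0 ≤ K) (h : ∀ ξ, ‖ξ‖ = 1 → hess w x ξ ξ ≤ K) : ‖hess w x‖ ≤ K := by
  have hquad : ∀ v, hess w x v v ≤ K * ‖v‖ ^ 2 := by
    intro v
    rcases eq_or_ne v 0 with rfl | hv
    · simp
    have hv' : ‖v‖ ≠ 0 := norm_ne_zero_iff.2 hv
    have h1 := h (‖v‖⁻¹ • v) (by rw [norm_smul, norm_inv, norm_norm, inv_mul_cancel₀ hv'])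
    simp only [map_smul, _root_.smul_apply, smul_eq_mul] at h1
    have : 0 < ‖v‖ := norm_pos_iff.2 hv
    field_simp at h1
    linarith
  have hcs : ∀ a b, hess w x a b ^ 2 ≤ hess w x a a * hess w x b b := by
    intro a b
    let L : LinearMap.BilinForm ℝ (EuclideanSpace ℝ (Fin n)) :=
      LinearMap.mk₂ ℝ (fun a b => hess w x a b) (by simp) (by simp) (by simp) (by simp)
    exact LinearMap.BilinForm.apply_sq_le_of_symm L hpsd ⟨fun a b => hess_symm hw a b⟩ a b
  refine ContinuousLinearMap.opNorm_le_bound _ hK fun a =>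
    ContinuousLinearMap.opNorm_le_bound _ (by positivity) fun b => ?_
  rw [Real.norm_eq_abs]
  refine abs_le_of_sq_le_sq ?_ (by positivity)
  calc hess w x a b ^ 2 ≤ hess w x a a * hess w x b b := hcs a b
    _ ≤ (K * ‖a‖ ^ 2) * (K * ‖b‖ ^ 2) :=
      mul_le_mul (hquad a) (hquad b) (hpsd b) (by positivity)
    _ = (K * ‖a‖ * ‖b‖) ^ 2 := by ring

end Pogorelov

/-- **Pogorelov-type estimate** for `det D²w = (x·Dw − w)^{−q}`:
if `w ∈ C⁴` near `Ω̄`, convex on `Ω`, `w = 0` on `∂Ω`, `|Dw| ≤ M`, and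
`x·Dw − w > 0` in `Ω`, then `(−w)·‖D²w‖ ≤ C` on `Ω`, with `C = C(n, q, M)`. -/
theorem pogorelov_estimate
    (n : ℕ) (hn : 2 ≤ n) (q M : ℝ) (hq0 : 0 ≤ q) (hqn : q < n) (hM : 0 < M) :
    ∃ C : ℝ, 0 < C ∧
      ∀ (Ω U : Set (EuclideanSpace ℝ (Fin n))) (w : EuclideanSpace ℝ (Fin n) → ℝ),
        IsOpen Ω → Bornology.IsBounded Ω →
        IsOpen U → closure Ω ⊆ U → ContDiffOn ℝ 4 w U →
        ConvexOn ℝ Ω w →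
        (∀ x ∈ frontier Ω, w x = 0) →
        (∀ x ∈ Ω, ‖gradient w x‖ ≤ M) →
        (∀ x ∈ Ω, 0 < ⟪x, gradient w x⟫ - w x) →
        (∀ x ∈ Ω, (hessMatrix w x).det = (⟪x, gradient w x⟫ - w x) ^ (-q)) →
        ∀ x ∈ Ω, (-(w x)) * ‖hess w x‖ ≤ C := by
  have hn0 : (0 : ℝ) < n := by exact_mod_cast (by omega : 0 < n)
  have hK0 : 0 < n + q + M := by linarith
  refine ⟨(n + q + M) * Real.exp (M ^ 2 / 2), by positivity, ?_⟩
  intro Ω U w hΩ hbdd hU hΩU hw hconv hbdry hgrad hpos hdet x hx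
  have hsub : Ω ⊆ U := subset_closure.trans hΩU
  have hw4 : ∀ y ∈ U, ContDiffAt ℝ 4 w y := fun y hy => hw.contDiffAt (hU.mem_nhds hy)
  have hw2 : ∀ y ∈ Ω, ContDiffAt ℝ 2 w y := fun y hy => (hw4 y (hsub hy)).of_le (by norm_num)
  have hinner : ∀ y, ⟪y, gradient w y⟫ = fderiv ℝ w y y := fun y => by
    simp [inner_gradient_right]
  simp only [hinner] at hpos hdet
  have hpsd : ∀ y ∈ Ω, ∀ v, 0 ≤ hess w y v v := fun y hy v =>
    hess_self_nonneg hΩ hconv hw2 hy v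
  have hV : ∀ y ∈ Ω, ∀ ξ : EuclideanSpace ℝ (Fin n), ‖ξ‖ = 1 → fderiv ℝ w y ξ ^ 2 ≤ M ^ 2 := by
    intro y hy ξ hξ
    have : |fderiv ℝ w y ξ| ≤ M := by
      rw [← inner_gradient_left]
      refine (abs_real_inner_le_norm _ _).trans ?_
      rw [hξ, mul_one]
      exact hgrad y hy
    exact sq_le_sq' (abs_le.1 this).1 (abs_le.1 this).2
  rcases le_or_gt 0 (w x) with hwx | hwx
  · exact (mul_nonpos_of_nonpos_of_nonneg (neg_nonpos.2 hwx) (norm_nonneg (hess w x))).trans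
      (by positivity)
  have hwx' : 0 < -w x := neg_pos.2 hwx
  rw [← le_div_iff₀' hwx']
  refine norm_hess_le (hw2 x hx) (hpsd x hx)
    (div_nonneg (by positivity) hwx'.le) fun ξ hξ => ?_
  rw [le_div_iff₀' hwx']
  rcases (hpsd x hx ξ).eq_or_lt with h0 | h0
  · rw [← h0, mul_zero]
    positivity
  let H : EuclideanSpace ℝ (Fin n) → ℝ := fun y =>
    -w y * hess w y ξ ξ * Real.exp (fderiv ℝ w y ξ ^ 2 / 2)
  have hHcont : ContinuousOn H (closure Ω) := by
    intro y hy
    have h4 := hw4 y (hΩU hy)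
    have c1 : ContinuousAt (fun y => hess w y ξ ξ) y :=
      ((h4.hess (m := 0) (by norm_num)).continuousAt.clm_apply continuousAt_const).clm_apply
        continuousAt_const
    have c2 : ContinuousAt (fun y => fderiv ℝ w y ξ) y :=
      (h4.fderiv_right (m := 0) (by norm_num)).continuousAt.clm_apply continuousAt_const
    exact ((h4.continuousAt.neg.mul c1).mul
      (((c2.pow 2).div_const 2).rexp)).continuousWithinAt
  obtain ⟨y, hy, hymax⟩ := hbdd.isCompact_closure.exists_isMaxOn ⟨x, subset_closure hx⟩ hHcont
  have hHx : -w x * hess w x ξ ξ ≤ H x := by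
    refine le_mul_of_one_le_right (mul_pos hwx' h0).le (Real.one_le_exp (by positivity))
  have hHy : 0 < H y :=
    ((mul_pos hwx' h0).trans_le hHx).trans_le (hymax (subset_closure hx))
  have hyΩ : y ∈ Ω := by
    by_contra hyn
    have : w y = 0 := hbdry y (by rw [hΩ.frontier_eq]; exact ⟨hy, hyn⟩)
    simp [H, this] at hHy
  have hpos2 : 0 < -w y * hess w y ξ ξ := pos_of_mul_pos_left hHy (Real.exp_pos _).le
  have hwy : w y < 0 := by
    have := pos_of_mul_pos_left hpos2 (hpsd y hyΩ ξ)
    linarith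
  have hsy : 0 < hess w y ξ ξ := pos_of_mul_pos_right hpos2 (by linarith)
  have hΩy := hΩ.mem_nhds hyΩ
  have hest := pogorelov_at_isLocalMax ⟨0, by omega⟩ hq0 (hw4 y (hsub hyΩ)) hwy hsy
    (hpsd y hyΩ) (hpos y hyΩ) (mem_of_superset hΩy hdet)
    (hymax.isLocalMax (mem_of_superset hΩy subset_closure))
  have hVy := hV y hyΩ ξ hξ
  have hX : -w y * hess w y ξ ξ ≤ n + q + M := by
    by_contra! hlt
    nlinarith
  calc -w x * hess w x ξ ξ ≤ H x := hHx
    _ ≤ H y := hymax (subset_closure hx)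
    _ ≤ (n + q + M) * Real.exp (M ^ 2 / 2) := by
      refine mul_le_mul hX (Real.exp_le_exp.2 (by linarith)) (Real.exp_pos _).le hK0.le
end
end
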